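/- Under the stated hypotheses, the Orbit 3 (K,L,L) three-term relation holds: A(1−a, e−a, f−a, g−a)·B_3(a,b,c,d,e,f,g)·K(a;b,c,d;e,f,g) + S(e−a)·A(f−a, f−b, f−c, f−d)·A(g−a, g−b, g−c, g−d)·A(a,b,c,d)·L(1−a, 1−b, 1−c, 1−d; 2−e; 2−f, 2−g) − A(e−a, e−b, e−c, e−d)·B_4(a,b,c,d,e,f,g)·L(a,b,c,d;e;f,g) = 0. -/

import Mathlib

noncomputable section

open Complex

/-- `Sn x = sin (π x)`. -/
def Sn (x : ℂ) : ℂ := Complex.sin ((Real.pi : ℂ) * x)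

/-- The renormalized Saalschützian series
`F*(a,b,c,d;e,f,g) = ∑ₖ Γ(k+a)Γ(k+b)Γ(k+c)Γ(k+d)/(k!·Γ(k+e)Γ(k+f)Γ(k+g))`. -/
def Fstar (a b c d e f g : ℂ) : ℂ :=
  ∑' k : ℕ, (Complex.Gamma (k + a) * Complex.Gamma (k + b) *
      Complex.Gamma (k + c) * Complex.Gamma (k + d)) /
    ((k.factorial : ℂ) * Complex.Gamma (k + e) * Complex.Gamma (k + f) *
      Complex.Gamma (k + g))

/-- The function `K(a;b,c,d;e,f,g)`. -/
def Kf (a b c d e f g : ℂ) : ℂ :=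
  (Fstar a b c d e f g +
      Fstar a (1 + a - e) (1 + a - f) (1 + a - g) (1 + a - b) (1 + a - c) (1 + a - d)) /
    (Sn a * Complex.Gamma a ^ 2 * Complex.Gamma b * Complex.Gamma c * Complex.Gamma d *
      Complex.Gamma (1 + a - e) * Complex.Gamma (1 + a - f) * Complex.Gamma (1 + a - g))

/-- The function `L(a,b,c,d;e;f,g)`. -/
def Lf (a b c d e f g : ℂ) : ℂ :=
  (Fstar a b c d e f g -
      Fstar (1 + a - e) (1 + b - e) (1 + c - e) (1 + d - e) (2 - e) (1 + f - e) (1 + g - e)) /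
    (Sn e * Complex.Gamma a * Complex.Gamma b * Complex.Gamma c * Complex.Gamma d *
      Complex.Gamma (1 + a - e) * Complex.Gamma (1 + b - e) * Complex.Gamma (1 + c - e) *
      Complex.Gamma (1 + d - e))

/-- `A(x,y,z,t) = 1/(Γ(x)Γ(y)Γ(z)Γ(t))`. -/
def Af (x y z t : ℂ) : ℂ :=
  1 / (Complex.Gamma x * Complex.Gamma y * Complex.Gamma z * Complex.Gamma t)

def B1 (a b c d e f g : ℂ) : ℂ :=
  Sn b * Sn c * (Sn (b - a) * Sn (c - a) * Sn d + Sn (e - a) * Sn (f - a) * Sn (g - a)) /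
    (Real.pi : ℂ) ^ 4

def B2 (a b c d e f g : ℂ) : ℂ :=
  Sn (f - a) * Sn (g - a) *
    (Sn (b - a) * Sn (c - a) * Sn (d - a) + Sn (e - 2 * a) * Sn (f - a) * Sn (g - a)) /
    (Real.pi : ℂ) ^ 4

def B3 (a b c d e f g : ℂ) : ℂ :=
  (Sn f * Sn (f - e) * Sn (g - a) * Sn (g - b) * Sn (g - c) * Sn (g - d) -
      Sn g * Sn (g - e) * Sn (f - a) * Sn (f - b) * Sn (f - c) * Sn (f - d)) /
    ((Real.pi : ℂ) ^ 4 * Sn (f - g))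

def B4 (a b c d e f g : ℂ) : ℂ :=
  Sn (f - a) * Sn (g - a) * (Sn b * Sn c * Sn d + Sn (e - a) * Sn f * Sn g) /
    (Real.pi : ℂ) ^ 4

def B5 (a b c d e f g : ℂ) : ℂ :=
  Sn b * Sn (e - b) *
    (Sn (b - a) * Sn (c - a) * Sn (d - a) + Sn (e - 2 * a) * Sn (f - a) * Sn (g - a)) /
    (Real.pi : ℂ) ^ 4

def Cf (a b c d e f g : ℂ) : ℂ :=
  Sn (e - a) * (Sn b * Sn c * Sn d * B2 a b c d e f g +
      Sn e * Sn (f - a) * Sn (g - a) * B4 a b c d e f g) / (Real.pi : ℂ) ^ 4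

open Filter Topology in
theorem tendsto_rpow_mul_Gamma_ratio {x y : ℝ} (hx : 0 < x) (hy : 0 < y) :
    Tendsto (fun n : ℕ => (n : ℝ) ^ (y - x) * (Real.Gamma (n + x) / Real.Gamma (n + y)))
      atTop (𝓝 1) := by
  have key : ∀ z : ℝ, 0 < z → Tendsto (fun n : ℕ =>
      Real.Gamma (n + z) * (n + z) / ((n : ℝ) ^ z * n.factorial)) atTop (𝓝 1) := by
    intro z hz
    have h1 := (tendsto_const_nhds (x := Real.Gamma z)).div (Real.GammaSeq_tendsto_Gamma z)
      (Real.Gamma_pos_of_pos hz).ne'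
    rw [div_self (Real.Gamma_pos_of_pos hz).ne'] at h1
    refine h1.congr fun n => ?_
    have hprod : ∀ m : ℕ, Real.Gamma z * ∏ j ∈ Finset.range m, (z + j) = Real.Gamma (m + z) := by
      intro m
      induction m with
      | zero => simp
      | succ m ih =>
        rw [Finset.prod_range_succ, ← mul_assoc, ih]
        push_cast
        rw [show (m : ℝ) + 1 + z = (m + z) + 1 by ring, Real.Gamma_add_one (by positivity)]
        ring
    have h2 := hprod (n + 1)
    push_cast at h2
    rw [show (n : ℝ) + 1 + z = (n + z) + 1 by ring, Real.Gamma_add_one (by positivity)] at h2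
    simp only [Pi.div_apply, Real.GammaSeq]
    rw [div_div_eq_mul_div, h2]
    ring
  have hlin : Tendsto (fun n : ℕ => ((n : ℝ) + y) / (n + x)) atTop (𝓝 1) := by
    have h0 : Tendsto (fun n : ℕ => (y - x) / ((n : ℝ) + x)) atTop (𝓝 0) :=
      tendsto_const_nhds.div_atTop
        (tendsto_atTop_add_const_right _ _ tendsto_natCast_atTop_atTop)
    have h1 := h0.const_add 1
    rw [add_zero] at h1
    refine h1.congr fun n => ?_
    have : (n : ℝ) + x ≠ 0 := by positivity
    field_simp
    ring
  have h3 := ((key x hx).div (key y hy) one_ne_zero).mul hlin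
  rw [div_one, mul_one] at h3
  refine h3.congr' ?_
  filter_upwards [eventually_gt_atTop 0] with n hn
  have hn' : (0 : ℝ) < n := by exact_mod_cast hn
  have h4 : (0 : ℝ) < Real.Gamma (n + y) := Real.Gamma_pos_of_pos (by positivity)
  have h5 : (n : ℝ) + x ≠ 0 := by positivity
  have h6 : (n : ℝ) + y ≠ 0 := by positivity
  simp only [Pi.div_apply]
  rw [Real.rpow_sub hn']
  field_simp

theorem exists_Gamma_ratio_le {x y : ℝ} (hx : 0 < x) (hy : 0 < y) :
    ∃ B : ℝ, 0 < B ∧ ∀ n : ℕ, 1 ≤ n →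
      Real.Gamma (n + x) / Real.Gamma (n + y) ≤ B * (n : ℝ) ^ (x - y) := by
  obtain ⟨B, hB⟩ := (tendsto_rpow_mul_Gamma_ratio hx hy).bddAbove_range
  refine ⟨max B 1, by positivity, fun n hn => ?_⟩
  have hn' : (0 : ℝ) < n := by exact_mod_cast hn
  have h1 : (n : ℝ) ^ (y - x) * (Real.Gamma (n + x) / Real.Gamma (n + y)) ≤ max B 1 :=
    (hB ⟨n, rfl⟩).trans (le_max_left _ _)
  rw [show x - y = -(y - x) by ring, Real.rpow_neg hn'.le, ← div_eq_mul_inv,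
    le_div_iff₀ (by positivity), mul_comm]
  exact h1

/-- Telescoping of the difference of two series. -/
theorem tsum_eq_limit_of_telescope {u H : ℕ → ℝ} {l : ℝ} (hu : Summable u)
    (hH : ∀ k, u k = H (k + 1) - H k) (h0 : H 0 = 0)
    (hl : Filter.Tendsto H Filter.atTop (nhds l)) : ∑' k, u k = l := by
  have h1 := hu.hasSum.tendsto_sum_nat
  refine tendsto_nhds_unique h1 (hl.congr fun n => ?_)
  simp only [hH, Finset.sum_range_sub, h0, sub_zero]

theorem Gamma_natCast_succ_add {x : ℝ} (hx : 0 < x) (k : ℕ) :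
    Real.Gamma ((k + 1 : ℕ) + x) = (k + x) * Real.Gamma (k + x) := by
  push_cast
  rw [show (k : ℝ) + 1 + x = (k + x) + 1 by ring, Real.Gamma_add_one (by positivity)]

theorem Gamma_natCast_add_pos {x : ℝ} (hx : 0 < x) (k : ℕ) : 0 < Real.Gamma (k + x) :=
  Real.Gamma_pos_of_pos (by positivity)

theorem factorial_eq_Gamma (k : ℕ) : (k.factorial : ℝ) = Real.Gamma (k + 1) :=
  (Real.Gamma_nat_eq_factorial k).symm

/-- General term of a Gauss series. -/
def gaussTerm (a b e : ℝ) (k : ℕ) : ℝ :=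
  Real.Gamma (k + a) * Real.Gamma (k + b) / (k.factorial * Real.Gamma (k + e))

theorem gaussTerm_pos {a b e : ℝ} (ha : 0 < a) (hb : 0 < b) (he : 0 < e) (k : ℕ) :
    0 < gaussTerm a b e k := by
  have := Gamma_natCast_add_pos ha k
  have := Gamma_natCast_add_pos hb k
  have := Gamma_natCast_add_pos he k
  unfold gaussTerm
  positivity

theorem gaussTerm_le {a b e : ℝ} (ha : 0 < a) (hb : 0 < b) (he : 0 < e) :
    ∃ B : ℝ, 0 < B ∧ ∀ k : ℕ, 1 ≤ k → gaussTerm a b e k ≤ B * (k : ℝ) ^ (a + b - 1 - e) := by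
  obtain ⟨B₁, hB₁, h1⟩ := exists_Gamma_ratio_le ha one_pos
  obtain ⟨B₂, hB₂, h2⟩ := exists_Gamma_ratio_le hb he
  refine ⟨B₁ * B₂, by positivity, fun k hk => ?_⟩
  have hk' : (0 : ℝ) < k := by exact_mod_cast hk
  have h3 := Gamma_natCast_add_pos hb k
  have h4 := Gamma_natCast_add_pos he k
  calc gaussTerm a b e k = (Real.Gamma (k + a) / Real.Gamma (k + 1)) *
        (Real.Gamma (k + b) / Real.Gamma (k + e)) := by
        unfold gaussTerm; rw [factorial_eq_Gamma, div_mul_div_comm]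
    _ ≤ (B₁ * (k : ℝ) ^ (a - 1)) * (B₂ * (k : ℝ) ^ (b - e)) :=
        mul_le_mul (h1 k hk) (h2 k hk) (by positivity) (by positivity)
    _ = B₁ * B₂ * (k : ℝ) ^ (a + b - 1 - e) := by
        rw [show a + b - 1 - e = (a - 1) + (b - e) by ring, Real.rpow_add hk']; ring

theorem summable_of_le_rpow {u : ℕ → ℝ} {B p : ℝ} (hu : ∀ k, 0 ≤ u k)
    (h : ∀ k : ℕ, 1 ≤ k → u k ≤ B * (k : ℝ) ^ p) (hp : p < -1) : Summable u := by
  rw [← summable_nat_add_iff 1]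
  refine Summable.of_nonneg_of_le (fun k => hu _) (fun k => h (k + 1) (by omega)) ?_
  exact (summable_nat_add_iff (f := fun k : ℕ => B * (k : ℝ) ^ p) 1).2
    ((Real.summable_nat_rpow.2 hp).mul_left B)

theorem summable_gaussTerm {a b e : ℝ} (ha : 0 < a) (hb : 0 < b) (he : a + b < e) :
    Summable (gaussTerm a b e) := by
  obtain ⟨B, -, hB⟩ := gaussTerm_le ha hb (by linarith : 0 < e)
  exact summable_of_le_rpow (fun k => (gaussTerm_pos ha hb (by linarith) k).le) hB (by linarith)

open Filter Topology in
theorem tsum_gaussTerm_contiguous {a b e : ℝ} (ha : 0 < a) (hb : 0 < b) (he : a + b < e) :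
    (e - a) * (e - b) * ∑' k, gaussTerm a b (e + 1) k = (e - a - b) * ∑' k, gaussTerm a b e k := by
  have he0 : 0 < e := by linarith
  have s1 := (summable_gaussTerm ha hb he).mul_left (e - a - b)
  have s2 := (summable_gaussTerm ha hb (by linarith : a + b < e + 1)).mul_left ((e - a) * (e - b))
  rw [← sub_eq_zero, ← tsum_mul_left, ← tsum_mul_left, ← s2.tsum_sub s1]
  refine tsum_eq_limit_of_telescope (H := fun k : ℕ => k * gaussTerm a b e k) (s2.sub s1)
    (fun k => ?_) (by simp) ?_
  · have h1 : Real.Gamma ((k : ℝ) + (e + 1)) = (k + e) * Real.Gamma (k + e) := by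
      rw [← add_assoc, Real.Gamma_add_one (by positivity)]
    have h2 := Gamma_natCast_add_pos he0 k
    have h3 : (0 : ℝ) < k + e := by positivity
    simp only [gaussTerm, h1, Gamma_natCast_succ_add ha, Gamma_natCast_succ_add hb,
      Gamma_natCast_succ_add he0, Nat.factorial_succ]
    push_cast
    field_simp
    ring
  · obtain ⟨B, hB0, hB⟩ := gaussTerm_le ha hb he0
    have hlim : Tendsto (fun k : ℕ => B * (k : ℝ) ^ (-(e - a - b))) atTop (𝓝 (B * 0)) :=
      ((tendsto_rpow_neg_atTop (by linarith)).comp tendsto_natCast_atTop_atTop).const_mul B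
    rw [mul_zero] at hlim
    refine squeeze_zero' (Eventually.of_forall fun k => ?_) ?_ hlim
    · exact mul_nonneg (by positivity) (gaussTerm_pos ha hb he0 k).le
    · filter_upwards [eventually_ge_atTop 1] with k hk
      have hk' : (0 : ℝ) < k := by exact_mod_cast hk
      calc (k : ℝ) * gaussTerm a b e k ≤ k * (B * (k : ℝ) ^ (a + b - 1 - e)) := by
            gcongr; exact hB k hk
        _ = B * ((k : ℝ) ^ (1 : ℝ) * (k : ℝ) ^ (a + b - 1 - e)) := by rw [Real.rpow_one]; ring
        _ = B * (k : ℝ) ^ (-(e - a - b)) := by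
            rw [← Real.rpow_add hk']; congr 2; ring

open Filter Topology in
theorem tendsto_Gamma_mul_tsum_gaussTerm {a b e : ℝ} (ha : 0 < a) (hb : 0 < b) (he : a + b < e) :
    Tendsto (fun N : ℕ => Real.Gamma (N + e) * ∑' k, gaussTerm a b (N + e) k) atTop
      (𝓝 (Real.Gamma a * Real.Gamma b)) := by
  have he0 : 0 < e := by linarith
  have hlim : ∑' k : ℕ, (if k = 0 then Real.Gamma a * Real.Gamma b else 0) =
      Real.Gamma a * Real.Gamma b := by simp
  rw [← hlim]
  simp_rw [← tsum_mul_left]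
  have ratio : ∀ N k : ℕ, Real.Gamma (N + e) / Real.Gamma (k + (N + e)) ≤
      Real.Gamma e / Real.Gamma (k + e) := by
    intro N k
    induction N with
    | zero => simp
    | succ N ih =>
      refine le_trans ?_ ih
      rw [Gamma_natCast_succ_add he0, show (k : ℝ) + ((N + 1 : ℕ) + e) = (k + (N + e)) + 1 by
        push_cast; ring, Real.Gamma_add_one (by positivity), mul_div_mul_comm]
      have h1 := Gamma_natCast_add_pos he0 N
      have h2 : 0 < Real.Gamma ((k : ℝ) + (N + e)) := Real.Gamma_pos_of_pos (by positivity)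
      refine mul_le_of_le_one_left (by positivity) ?_
      rw [div_le_one (by positivity)]
      have : (0 : ℝ) ≤ k := by positivity
      linarith
  refine tendsto_tsum_of_dominated_convergence
    (bound := fun k => Real.Gamma e * gaussTerm a b e k)
    ((summable_gaussTerm ha hb he).mul_left _) (fun k => ?_) (Eventually.of_forall fun N k => ?_)
  · rcases Nat.eq_zero_or_pos k with rfl | hk
    · refine tendsto_const_nhds.congr fun N => ?_
      have := (Gamma_natCast_add_pos he0 N).ne'
      simp [gaussTerm]
      field_simp
    · have hk' : (0 : ℝ) < k := by exact_mod_cast hk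
      have h1 := tendsto_rpow_mul_Gamma_ratio he0 (by positivity : 0 < k + e)
      have h2 : Tendsto (fun N : ℕ => (N : ℝ) ^ (-(k : ℝ))) atTop (𝓝 0) :=
        (tendsto_rpow_neg_atTop hk').comp tendsto_natCast_atTop_atTop
      have h3 := (h1.mul h2).mul_const (Real.Gamma (k + a) * Real.Gamma (k + b) / k.factorial)
      rw [if_neg hk.ne']
      simp only [mul_zero, zero_mul] at h3
      refine h3.congr' ?_
      filter_upwards [eventually_gt_atTop 0] with N hN
      have hN' : (0 : ℝ) < N := by exact_mod_cast hN
      have h4 : (N : ℝ) ^ ((k : ℝ) + e - e) * (N : ℝ) ^ (-(k : ℝ)) = 1 := by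
        rw [← Real.rpow_add hN']; simp
      rw [show (N : ℝ) ^ ((k : ℝ) + e - e) * (Real.Gamma (N + e) / Real.Gamma (N + (k + e))) *
        (N : ℝ) ^ (-(k : ℝ)) = ((N : ℝ) ^ ((k : ℝ) + e - e) * (N : ℝ) ^ (-(k : ℝ))) *
        (Real.Gamma (N + e) / Real.Gamma (N + (k + e))) by ring, h4,
        show (N : ℝ) + (k + e) = k + (N + e) by ring]
      simp only [gaussTerm]
      ring
  · have h1 := Gamma_natCast_add_pos he0 N
    have h2 := gaussTerm_pos ha hb (by positivity : (0:ℝ) < N + e) k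
    have h3 := Gamma_natCast_add_pos ha k
    have h4 := Gamma_natCast_add_pos hb k
    rw [Real.norm_of_nonneg (by positivity)]
    have h5 : ∀ x : ℝ, Real.Gamma x * gaussTerm a b x k =
      Real.Gamma (k + a) * Real.Gamma (k + b) / k.factorial *
        (Real.Gamma x / Real.Gamma (k + x)) := by
      intro x; simp only [gaussTerm]; ring
    rw [h5, h5]
    exact mul_le_mul_of_nonneg_left (ratio N k) (by positivity)

open Filter Topology in
/-- Gauss's summation theorem for positive parameters. -/
theorem tsum_gaussTerm {a b e : ℝ} (ha : 0 < a) (hb : 0 < b) (he : a + b < e) :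
    ∑' k, gaussTerm a b e k = Real.Gamma a * Real.Gamma b * Real.Gamma (e - a - b) /
      (Real.Gamma (e - a) * Real.Gamma (e - b)) := by
  have he0 : 0 < e := by linarith
  have h1 : 0 < e - a - b := by linarith
  have h2 : 0 < e - a := by linarith
  have h3 : 0 < e - b := by linarith
  have inv : ∀ N : ℕ, Real.Gamma (N + (e - a)) * Real.Gamma (N + (e - b)) /
      Real.Gamma (N + (e - a - b)) * ∑' k, gaussTerm a b (N + e) k =
      Real.Gamma (e - a) * Real.Gamma (e - b) / Real.Gamma (e - a - b) *
        ∑' k, gaussTerm a b e k := by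
    intro N
    induction N with
    | zero => simp
    | succ N ih =>
      rw [← ih, Gamma_natCast_succ_add h1, Gamma_natCast_succ_add h2, Gamma_natCast_succ_add h3]
      have h4 := tsum_gaussTerm_contiguous ha hb (e := N + e) (by
        have : (0 : ℝ) ≤ N := by positivity
        linarith)
      have h5 := Gamma_natCast_add_pos h1 N
      have h6 : (0 : ℝ) < N + (e - a - b) := by positivity
      rw [show ((N + 1 : ℕ) : ℝ) + e = N + e + 1 by push_cast; ring]
      field_simp
      linear_combination h4
  have h4 := tendsto_Gamma_mul_tsum_gaussTerm ha hb he
  have h5 := tendsto_rpow_mul_Gamma_ratio h2 he0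
  have h6 := tendsto_rpow_mul_Gamma_ratio h3 h1
  have h7 := (h5.mul h6).mul h4
  have h8 : Tendsto (fun _ : ℕ => Real.Gamma (e - a) * Real.Gamma (e - b) /
      Real.Gamma (e - a - b) * ∑' k, gaussTerm a b e k) atTop
      (𝓝 (1 * 1 * (Real.Gamma a * Real.Gamma b))) := by
    refine h7.congr' ?_
    filter_upwards [eventually_gt_atTop 0] with N hN
    have hN' : (0 : ℝ) < N := by exact_mod_cast hN
    have h9 := Gamma_natCast_add_pos he0 N
    rw [← inv N]
    have h10 : (N : ℝ) ^ (e - (e - a)) * (N : ℝ) ^ (e - a - b - (e - b)) = 1 := by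
      rw [← Real.rpow_add hN', show e - (e - a) + (e - a - b - (e - b)) = 0 by ring,
        Real.rpow_zero]
    have h11 := Gamma_natCast_add_pos h1 N
    field_simp
    linear_combination (∑' k, gaussTerm a b (N + e) k) * h10
  have h9 := tendsto_nhds_unique tendsto_const_nhds h8
  have g1 := Real.Gamma_pos_of_pos h1
  have g2 := Real.Gamma_pos_of_pos h2
  have g3 := Real.Gamma_pos_of_pos h3
  field_simp at h9 ⊢
  linear_combination h9

/-- A three-over-two series at unit argument, with lower parameter `c + h`. -/
def threeTwo (a b c e h : ℝ) : ℝ :=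
  ∑' k : ℕ, gaussTerm a b e k * (Real.Gamma (k + c) / Real.Gamma (k + (c + h)))

theorem summable_threeTwo {a b c e h : ℝ} (ha : 0 < a) (hb : 0 < b) (hc : 0 < c) (he : 0 < e)
    (hh : 0 < h) (hs : a + b < e + h) :
    Summable fun k : ℕ => gaussTerm a b e k * (Real.Gamma (k + c) / Real.Gamma (k + (c + h))) := by
  obtain ⟨B₁, hB₁, h1⟩ := gaussTerm_le ha hb he
  obtain ⟨B₂, hB₂, h2⟩ := exists_Gamma_ratio_le hc (by linarith : 0 < c + h)
  have hpos : ∀ k : ℕ, 0 < Real.Gamma (k + c) / Real.Gamma (k + (c + h)) := fun k =>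
    div_pos (Gamma_natCast_add_pos hc k) (Gamma_natCast_add_pos (by linarith) k)
  refine summable_of_le_rpow (B := B₁ * B₂) (p := (a + b - 1 - e) + (c - (c + h)))
    (fun k => (mul_pos (gaussTerm_pos ha hb he k) (hpos k)).le) (fun k hk => ?_) (by linarith)
  have hk' : (0 : ℝ) < k := by exact_mod_cast hk
  rw [Real.rpow_add hk']
  calc _ ≤ (B₁ * (k : ℝ) ^ (a + b - 1 - e)) * (B₂ * (k : ℝ) ^ (c - (c + h))) :=
        mul_le_mul (h1 k hk) (h2 k hk) (hpos k).le (by positivity)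
    _ = _ := by ring

open Filter Topology in
theorem threeTwo_contiguous {a b c e : ℝ} (ha : 0 < a) (hb : 0 < b) (hc : 0 < c) (he : 0 < e)
    (hC : 0 < a + b + 1 - e) :
    (1 + c - e + a) * (1 + c - e + b) * threeTwo a b (c + 1) e (a + b + 1 - e) -
      c * (1 + c - e) * threeTwo a b c e (a + b + 1 - e) = 1 := by
  set C := a + b + 1 - e with hCdef
  have s1 := (summable_threeTwo ha hb hc he hC (by linarith)).mul_left (c * (1 + c - e))
  have s2 := (summable_threeTwo ha hb (by linarith : 0 < c + 1) he hC (by linarith)).mul_left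
    ((1 + c - e + a) * (1 + c - e + b))
  unfold threeTwo
  rw [← tsum_mul_left, ← tsum_mul_left, ← s2.tsum_sub s1]
  refine tsum_eq_limit_of_telescope (H := fun k : ℕ => k * (k + e - 1) *
    (gaussTerm a b e k * (Real.Gamma (k + c) / Real.Gamma (k + (c + C))))) (s2.sub s1)
    (fun k => ?_) (by simp) ?_
  · have hcC : 0 < c + C := by linarith
    have h1 : Real.Gamma ((k : ℝ) + (c + 1)) = (k + c) * Real.Gamma (k + c) := by
      rw [← add_assoc, Real.Gamma_add_one (by positivity)]
    have h1' : Real.Gamma ((k : ℝ) + (c + 1 + C)) = (k + (c + C)) * Real.Gamma (k + (c + C)) := by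
      rw [show (k : ℝ) + (c + 1 + C) = (k + (c + C)) + 1 by ring, Real.Gamma_add_one (by positivity)]
    have h2 := Gamma_natCast_add_pos he k
    have h3 := Gamma_natCast_add_pos hcC k
    have h4 : (0 : ℝ) < k + e := by positivity
    have h5 : (0 : ℝ) < k + (c + C) := by positivity
    simp only [gaussTerm, h1, h1', Gamma_natCast_succ_add ha, Gamma_natCast_succ_add hb,
      Gamma_natCast_succ_add he, Gamma_natCast_succ_add hc, Gamma_natCast_succ_add hcC,
      Nat.factorial_succ]
    push_cast
    field_simp
    rw [hCdef]
    ring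
  · have hlin : Tendsto (fun k : ℕ => 1 + (e - 1) / (k : ℝ)) atTop (𝓝 (1 + 0)) :=
      (tendsto_const_nhds.div_atTop tendsto_natCast_atTop_atTop).const_add 1
    have h1 := tendsto_rpow_mul_Gamma_ratio ha one_pos
    have h2 := tendsto_rpow_mul_Gamma_ratio hb he
    have h3 := tendsto_rpow_mul_Gamma_ratio hc (by linarith : 0 < c + C)
    have h4 := ((h1.mul h2).mul h3).mul hlin
    simp only [mul_one, add_zero] at h4
    refine h4.congr' ?_
    filter_upwards [eventually_gt_atTop 0] with k hk
    have hk' : (0 : ℝ) < k := by exact_mod_cast hk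
    have h5 : (k : ℝ) ^ (1 - a) * (k : ℝ) ^ (e - b) * (k : ℝ) ^ (c + C - c) = k ^ 2 := by
      rw [← Real.rpow_add hk', ← Real.rpow_add hk', ← Real.rpow_natCast]
      congr 1
      rw [hCdef]
      push_cast
      ring
    calc _ = ((k : ℝ) ^ (1 - a) * (k : ℝ) ^ (e - b) * (k : ℝ) ^ (c + C - c)) *
          (1 + (e - 1) / (k : ℝ)) * (gaussTerm a b e k *
            (Real.Gamma (k + c) / Real.Gamma (k + (c + C)))) := by
          rw [gaussTerm, factorial_eq_Gamma]; ring
      _ = _ := by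
          rw [h5]
          field_simp
          ring

open Filter Topology in
theorem tendsto_rpow_mul_threeTwo {a b c e h : ℝ} (ha : 0 < a) (hb : 0 < b) (hc : 0 < c)
    (hh : 0 < h) (he : a + b < e) :
    Tendsto (fun N : ℕ => (N : ℝ) ^ h * threeTwo a b (N + c) e h) atTop
      (𝓝 (∑' k, gaussTerm a b e k)) := by
  have he0 : 0 < e := by linarith
  have hch : 0 < c + h := by linarith
  obtain ⟨B, hB0, hB⟩ := exists_Gamma_ratio_le hc hch
  unfold threeTwo
  simp_rw [← tsum_mul_left]
  refine tendsto_tsum_of_dominated_convergence (bound := fun k => B * gaussTerm a b e k)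
    ((summable_gaussTerm ha hb he).mul_left _) (fun k => ?_) ?_
  · have h1 := tendsto_rpow_mul_Gamma_ratio (by positivity : 0 < k + c)
      (by positivity : 0 < k + (c + h))
    have h2 := h1.mul_const (gaussTerm a b e k)
    rw [one_mul] at h2
    refine h2.congr fun N => ?_
    rw [show (k : ℝ) + (c + h) - (k + c) = h by ring, show (N : ℝ) + (k + c) = k + (N + c) by ring,
      show (N : ℝ) + (k + (c + h)) = k + (N + c + h) by ring]
    ring
  · filter_upwards [eventually_ge_atTop 1] with N hN k
    have hN' : (0 : ℝ) < N := by exact_mod_cast hN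
    have h1 := gaussTerm_pos ha hb he0 k
    have h2 := hB (N + k) (by omega)
    have e1 : (((N + k : ℕ) : ℝ) + c) = k + (N + c) := by push_cast; ring
    have e2 : (((N + k : ℕ) : ℝ) + (c + h)) = k + (N + c + h) := by push_cast; ring
    have h3 := Gamma_natCast_add_pos hc (N + k)
    have h4 := Gamma_natCast_add_pos hch (N + k)
    rw [e1] at h3
    rw [e2] at h4
    rw [e1, e2, show c - (c + h) = -h by ring, Real.rpow_neg (by positivity)] at h2
    have h5 : (N : ℝ) ^ h ≤ ((N + k : ℕ) : ℝ) ^ h :=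
      Real.rpow_le_rpow hN'.le (by push_cast; linarith [(Nat.cast_nonneg k : (0 : ℝ) ≤ k)]) hh.le
    have h6 : (0 : ℝ) < ((N + k : ℕ) : ℝ) ^ h := Real.rpow_pos_of_pos (by positivity) _
    rw [Real.norm_of_nonneg (by positivity)]
    calc (N : ℝ) ^ h * (gaussTerm a b e k *
          (Real.Gamma (k + (N + c)) / Real.Gamma (k + (N + c + h))))
        ≤ ((N + k : ℕ) : ℝ) ^ h * (gaussTerm a b e k * (B * (((N + k : ℕ) : ℝ) ^ h)⁻¹)) := by
          gcongr
      _ = B * gaussTerm a b e k := by field_simp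

/-- The difference of a three-over-two series and its companion attached to the lower parameter `e`. -/
def threeTwoPair (a b c e h : ℝ) : ℝ :=
  threeTwo a b c e h - threeTwo (1 + a - e) (1 + b - e) (1 + c - e) (2 - e) h

theorem gauss_sub_gauss {a b e : ℝ} (ha : 0 < a) (hb : 0 < b) (hs : a + b < e)
    (ha' : 0 < 1 + a - e) (hb' : 0 < 1 + b - e) :
    ∑' k, gaussTerm a b e k - ∑' k, gaussTerm (1 + a - e) (1 + b - e) (2 - e) k =
      Real.sin (Real.pi * e) / Real.pi * (Real.Gamma a * Real.Gamma b * Real.Gamma (1 + a - e) *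
        Real.Gamma (1 + b - e)) / Real.Gamma (a + b + 1 - e) := by
  have hC : 0 < a + b + 1 - e := by linarith
  rw [tsum_gaussTerm ha hb hs, tsum_gaussTerm ha' hb' (by linarith),
    show 2 - e - (1 + a - e) - (1 + b - e) = e - a - b by ring,
    show 2 - e - (1 + a - e) = 1 - a by ring, show 2 - e - (1 + b - e) = 1 - b by ring]
  have r1 := Real.Gamma_mul_Gamma_one_sub a
  have r2 := Real.Gamma_mul_Gamma_one_sub b
  have r3 := Real.Gamma_mul_Gamma_one_sub (e - a)
  have r4 := Real.Gamma_mul_Gamma_one_sub (e - b)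
  have r5 := Real.Gamma_mul_Gamma_one_sub (e - a - b)
  rw [show 1 - (e - a) = 1 + a - e by ring] at r3
  rw [show 1 - (e - b) = 1 + b - e by ring] at r4
  rw [show 1 - (e - a - b) = a + b + 1 - e by ring] at r5
  have sinpos : ∀ x : ℝ, 0 < x → x < 1 → 0 < Real.sin (Real.pi * x) := fun x h0 h1 =>
    Real.sin_pos_of_pos_of_lt_pi (by positivity) (by nlinarith [Real.pi_pos])
  have s1 := sinpos a ha (by linarith)
  have s2 := sinpos b hb (by linarith)
  have s3 := sinpos (e - a) (by linarith) (by linarith)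
  have s4 := sinpos (e - b) (by linarith) (by linarith)
  have s5 := sinpos (e - a - b) (by linarith) (by linarith)
  have g1 := Real.Gamma_pos_of_pos ha
  have g2 := Real.Gamma_pos_of_pos hb
  have g3 := Real.Gamma_pos_of_pos ha'
  have g4 := Real.Gamma_pos_of_pos hb'
  have g5 := Real.Gamma_pos_of_pos hC
  have key : Real.sin (Real.pi * (e - a)) * Real.sin (Real.pi * (e - b)) -
      Real.sin (Real.pi * a) * Real.sin (Real.pi * b) =
      Real.sin (Real.pi * e) * Real.sin (Real.pi * (e - a - b)) := by
    rw [show Real.pi * (e - a) = Real.pi * e - Real.pi * a by ring,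
      show Real.pi * (e - b) = Real.pi * e - Real.pi * b by ring,
      show Real.pi * (e - a - b) = Real.pi * e - Real.pi * a - Real.pi * b by ring]
    simp only [Real.sin_sub, Real.cos_sub]
    linear_combination (Real.sin (Real.pi * a) * Real.sin (Real.pi * b)) *
      (Real.sin_sq_add_cos_sq (Real.pi * e))
  have e1 : Real.Gamma (1 - a) = Real.pi / Real.sin (Real.pi * a) / Real.Gamma a := by
    rw [← r1]; field_simp
  have e2 : Real.Gamma (1 - b) = Real.pi / Real.sin (Real.pi * b) / Real.Gamma b := by
    rw [← r2]; field_simp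
  have e3 : Real.Gamma (e - a) = Real.pi / Real.sin (Real.pi * (e - a)) / Real.Gamma (1 + a - e) := by
    rw [← r3]; field_simp
  have e4 : Real.Gamma (e - b) = Real.pi / Real.sin (Real.pi * (e - b)) / Real.Gamma (1 + b - e) := by
    rw [← r4]; field_simp
  have e5 : Real.Gamma (e - a - b) =
      Real.pi / Real.sin (Real.pi * (e - a - b)) / Real.Gamma (a + b + 1 - e) := by
    rw [← r5]; field_simp
  rw [e1, e2, e3, e4, e5]
  have hpi := Real.pi_pos
  field_simp
  linear_combination key

open Filter Topology in
/-- The non-terminating form of Saalschütz's theorem. -/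
theorem threeTwoPair_saalschutz {a b c e : ℝ} (ha : 0 < a) (hb : 0 < b) (hc : 0 < c)
    (hs : a + b < e) (ha' : 0 < 1 + a - e) (hb' : 0 < 1 + b - e) (hc' : 0 < 1 + c - e) :
    threeTwoPair a b c e (a + b + 1 - e) =
      Real.Gamma c * Real.Gamma (1 + c - e) /
        (Real.Gamma (1 + c - e + a) * Real.Gamma (1 + c - e + b)) *
      (∑' k, gaussTerm a b e k - ∑' k, gaussTerm (1 + a - e) (1 + b - e) (2 - e) k) := by
  have he : 0 < e := by linarith
  have he' : 0 < 2 - e := by linarith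
  have hC : 0 < a + b + 1 - e := by linarith
  have hca : 0 < 1 + c - e + a := by linarith
  have hcb : 0 < 1 + c - e + b := by linarith
  have step : ∀ x : ℝ, 0 < x → 0 < 1 + x - e →
      (1 + x - e + a) * (1 + x - e + b) * threeTwoPair a b (x + 1) e (a + b + 1 - e) =
        x * (1 + x - e) * threeTwoPair a b x e (a + b + 1 - e) := by
    intro x hx hx'
    have h1 := threeTwo_contiguous ha hb hx he hC
    have h2 := threeTwo_contiguous ha' hb' hx' he' (by linarith)
    rw [show 1 + a - e + (1 + b - e) + 1 - (2 - e) = a + b + 1 - e by ring,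
      show 1 + (1 + x - e) - (2 - e) = x by ring] at h2
    unfold threeTwoPair
    rw [show 1 + (x + 1) - e = 1 + x - e + 1 by ring]
    linear_combination h1 - h2
  have inv : ∀ N : ℕ, Real.Gamma (N + (1 + c - e + a)) * Real.Gamma (N + (1 + c - e + b)) /
      (Real.Gamma (N + c) * Real.Gamma (N + (1 + c - e))) *
        threeTwoPair a b (N + c) e (a + b + 1 - e) =
      Real.Gamma (1 + c - e + a) * Real.Gamma (1 + c - e + b) /
      (Real.Gamma c * Real.Gamma (1 + c - e)) * threeTwoPair a b c e (a + b + 1 - e) := by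
    intro N
    induction N with
    | zero => simp
    | succ N ih =>
      rw [← ih, Gamma_natCast_succ_add hc, Gamma_natCast_succ_add hc', Gamma_natCast_succ_add hca,
        Gamma_natCast_succ_add hcb]
      have h4 := step (N + c) (by positivity) (by
        have : (0 : ℝ) ≤ N := by positivity
        linarith)
      have h5 := Gamma_natCast_add_pos hc N
      have h5' := Gamma_natCast_add_pos hc' N
      have h6 : (0 : ℝ) < N + c := by positivity
      have h6' : (0 : ℝ) < N + (1 + c - e) := by positivity
      rw [show ((N + 1 : ℕ) : ℝ) + c = N + c + 1 by push_cast; ring]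
      field_simp
      linear_combination h4
  have h1 := (tendsto_rpow_mul_threeTwo ha hb hc hC hs).sub
    (tendsto_rpow_mul_threeTwo ha' hb' hc' hC (by linarith : _ < 2 - e))
  have h2 := (tendsto_rpow_mul_Gamma_ratio hca hc).mul (tendsto_rpow_mul_Gamma_ratio hcb hc')
  have h3 := h2.mul h1
  have h8 : Tendsto (fun _ : ℕ => Real.Gamma (1 + c - e + a) * Real.Gamma (1 + c - e + b) /
      (Real.Gamma c * Real.Gamma (1 + c - e)) * threeTwoPair a b c e (a + b + 1 - e)) atTop
      (𝓝 (1 * 1 * (∑' k, gaussTerm a b e k -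
        ∑' k, gaussTerm (1 + a - e) (1 + b - e) (2 - e) k))) := by
    refine h3.congr' ?_
    filter_upwards [eventually_gt_atTop 0] with N hN
    have hN' : (0 : ℝ) < N := by exact_mod_cast hN
    rw [← inv N]
    have h10 : (N : ℝ) ^ (c - (1 + c - e + a)) * (N : ℝ) ^ (1 + c - e - (1 + c - e + b)) *
        (N : ℝ) ^ (a + b + 1 - e) = 1 := by
      rw [← Real.rpow_add hN', ← Real.rpow_add hN',
        show c - (1 + c - e + a) + (1 + c - e - (1 + c - e + b)) + (a + b + 1 - e) = 0 by ring,
        Real.rpow_zero]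
    unfold threeTwoPair
    rw [show 1 + (N + c) - e = N + (1 + c - e) by ring]
    linear_combination (Real.Gamma (N + (1 + c - e + a)) * Real.Gamma (N + (1 + c - e + b)) /
      (Real.Gamma (N + c) * Real.Gamma (N + (1 + c - e)))) *
      (threeTwo a b (N + c) e (a + b + 1 - e) -
        threeTwo (1 + a - e) (1 + b - e) (N + (1 + c - e)) (2 - e) (a + b + 1 - e)) * h10
  have h9 := tendsto_nhds_unique tendsto_const_nhds h8
  have g1 := Real.Gamma_pos_of_pos hc
  have g2 := Real.Gamma_pos_of_pos hc'
  have g3 := Real.Gamma_pos_of_pos hca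
  have g4 := Real.Gamma_pos_of_pos hcb
  rw [one_mul, one_mul] at h9
  rw [← h9]
  field_simp

theorem threeTwo_sub_succ {a b c e h : ℝ} (ha : 0 < a) (hb : 0 < b) (hc : 0 < c) (he : 0 < e)
    (hh : 0 < h) (hs : a + b < e + h) :
    threeTwo a b c e h - threeTwo a b (c + 1) e h = h * threeTwo a b c e (h + 1) := by
  unfold threeTwo
  rw [← (summable_threeTwo ha hb hc he hh hs).tsum_sub
    (summable_threeTwo ha hb (by linarith) he hh hs), ← tsum_mul_left]
  refine tsum_congr fun k => ?_
  have hp : (0 : ℝ) < k + (c + h) := by positivity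
  have h1 := Real.Gamma_pos_of_pos hp
  rw [show (k : ℝ) + (c + 1 + h) = k + (c + h) + 1 by ring,
    show (k : ℝ) + (c + (h + 1)) = k + (c + h) + 1 by ring,
    show (k : ℝ) + (c + 1) = k + c + 1 by ring,
    Real.Gamma_add_one hp.ne', Real.Gamma_add_one (by positivity : (k : ℝ) + c ≠ 0)]
  field_simp
  ring

theorem Gamma_mul_threeTwo_sub_succ {a b p e c : ℝ} (ha : 0 < a) (hb : 0 < b) (hp : 0 < p)
    (he : 0 < e) (hc : 0 < c) (hs : a + b < e + c) :
    Real.Gamma c * threeTwo a b p e c - Real.Gamma (c + 1) * threeTwo a b p e (c + 1) =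
      Real.Gamma c * threeTwo a b (p + 1) e c := by
  unfold threeTwo
  rw [← tsum_mul_left, ← tsum_mul_left, ← tsum_mul_left,
    ← ((summable_threeTwo ha hb hp he hc hs).mul_left _).tsum_sub
    ((summable_threeTwo ha hb hp he (by linarith : 0 < c + 1) (by linarith)).mul_left _)]
  refine tsum_congr fun k => ?_
  have hp : (0 : ℝ) < k + (p + c) := by positivity
  have h1 := Real.Gamma_pos_of_pos hp
  rw [show (k : ℝ) + (p + (c + 1)) = k + (p + c) + 1 by ring,
    show (k : ℝ) + (p + 1 + c) = k + (p + c) + 1 by ring,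
    show (k : ℝ) + (p + 1) = k + p + 1 by ring,
    Real.Gamma_add_one hp.ne', Real.Gamma_add_one (by positivity : (k : ℝ) + p ≠ 0),
    Real.Gamma_add_one hc.ne']
  field_simp
  ring

theorem threeTwoPair_eq {a b e : ℝ} (ha : 0 < a) (hb : 0 < b)
    (hs : a + b < e) (ha' : 0 < 1 + a - e) (hb' : 0 < 1 + b - e) (n : ℕ) :
    ∀ c : ℝ, 0 < c → 0 < 1 + c - e →
    threeTwoPair a b c e (n + (a + b + 1 - e)) =
      Real.sin (Real.pi * e) / Real.pi * (Real.Gamma (1 + a - e) * Real.Gamma (1 + b - e)) *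
        (Real.Gamma c / Real.Gamma (n + (a + b + 1 - e)) *
          threeTwo a b (n + (a + b + 1 - e)) (a + b + 1 - e) c) := by
  have hC : 0 < a + b + 1 - e := by linarith
  have he : 0 < e := by linarith
  have he' : 0 < 2 - e := by linarith
  induction n with
  | zero =>
    intro c hc hc'
    rw [Nat.cast_zero, zero_add, threeTwoPair_saalschutz ha hb hc hs ha' hb' hc',
      gauss_sub_gauss ha hb hs ha' hb']
    have h1 : threeTwo a b (a + b + 1 - e) (a + b + 1 - e) c =
        ∑' k, gaussTerm a b (a + b + 1 - e + c) k := by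
      refine tsum_congr fun k => ?_
      have := Gamma_natCast_add_pos hC k
      unfold gaussTerm
      field_simp
    rw [h1, tsum_gaussTerm ha hb (by linarith), show a + b + 1 - e + c - a - b = 1 + c - e by ring,
      show a + b + 1 - e + c - a = 1 + c - e + b by ring,
      show a + b + 1 - e + c - b = 1 + c - e + a by ring]
    have g1 := Real.Gamma_pos_of_pos hC
    have g2 := Real.Gamma_pos_of_pos (by linarith : 0 < 1 + c - e + b)
    have g3 := Real.Gamma_pos_of_pos (by linarith : 0 < 1 + c - e + a)
    field_simp
  | succ n ih =>
    intro c hc hc'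
    have hp : 0 < n + (a + b + 1 - e) := by positivity
    have h0 : (0 : ℝ) ≤ n := by positivity
    have i1 := ih c hc hc'
    have i2 := ih (c + 1) (by linarith) (by linarith)
    have r1 := threeTwo_sub_succ ha hb hc he hp (by linarith)
    have r2 := threeTwo_sub_succ ha' hb' hc' he' hp (by linarith)
    have r3 := Gamma_mul_threeTwo_sub_succ ha hb hp hC hc (by linarith)
    unfold threeTwoPair at i1 i2 ⊢
    rw [show 1 + (c + 1) - e = 1 + c - e + 1 by ring] at i2
    rw [show ((n + 1 : ℕ) : ℝ) + (a + b + 1 - e) = n + (a + b + 1 - e) + 1 by push_cast; ring,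
      Real.Gamma_add_one hp.ne']
    set p := n + (a + b + 1 - e)
    have g1 := Real.Gamma_pos_of_pos hp
    have key : p * (threeTwo a b c e (p + 1) -
        threeTwo (1 + a - e) (1 + b - e) (1 + c - e) (2 - e) (p + 1)) =
        Real.sin (Real.pi * e) / Real.pi * (Real.Gamma (1 + a - e) * Real.Gamma (1 + b - e)) *
        (Real.Gamma c / Real.Gamma p * threeTwo a b (p + 1) (a + b + 1 - e) c) := by
      linear_combination i1 - i2 - r1 + r2 + Real.sin (Real.pi * e) / Real.pi *
        (Real.Gamma (1 + a - e) * Real.Gamma (1 + b - e)) / Real.Gamma p * r3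
    refine mul_left_cancel₀ hp.ne' ?_
    rw [key]
    field_simp

/-- The real Saalschützian series. -/
def saalSeries (a b c d e f g : ℝ) : ℝ :=
  ∑' k : ℕ, gaussTerm a b e k *
    (Real.Gamma (k + c) * Real.Gamma (k + d) / (Real.Gamma (k + f) * Real.Gamma (k + g)))

theorem summable_saalSeries {a b c d e f g : ℝ} (ha : 0 < a) (hb : 0 < b) (hc : 0 < c)
    (hd : 0 < d) (he : 0 < e) (hf : 0 < f) (hg : 0 < g) (hs : e + f + g = a + b + c + d + 1) :
    Summable fun k : ℕ => gaussTerm a b e k *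
      (Real.Gamma (k + c) * Real.Gamma (k + d) / (Real.Gamma (k + f) * Real.Gamma (k + g))) := by
  obtain ⟨B₁, hB₁, h1⟩ := gaussTerm_le ha hb he
  obtain ⟨B₂, hB₂, h2⟩ := exists_Gamma_ratio_le hc hf
  obtain ⟨B₃, hB₃, h3⟩ := exists_Gamma_ratio_le hd hg
  have hp1 : ∀ k : ℕ, 0 < Real.Gamma (k + c) / Real.Gamma (k + f) := fun k =>
    div_pos (Gamma_natCast_add_pos hc k) (Gamma_natCast_add_pos hf k)
  have hp2 : ∀ k : ℕ, 0 < Real.Gamma (k + d) / Real.Gamma (k + g) := fun k =>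
    div_pos (Gamma_natCast_add_pos hd k) (Gamma_natCast_add_pos hg k)
  simp_rw [mul_div_mul_comm]
  refine summable_of_le_rpow (B := B₁ * (B₂ * B₃)) (p := (a + b - 1 - e) + ((c - f) + (d - g)))
    (fun k => (mul_pos (gaussTerm_pos ha hb he k) (mul_pos (hp1 k) (hp2 k))).le)
    (fun k hk => ?_) (by linarith)
  have hk' : (0 : ℝ) < k := by exact_mod_cast hk
  rw [Real.rpow_add hk', Real.rpow_add hk']
  calc _ ≤ (B₁ * (k : ℝ) ^ (a + b - 1 - e)) *
          ((B₂ * (k : ℝ) ^ (c - f)) * (B₃ * (k : ℝ) ^ (d - g))) :=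
        mul_le_mul (h1 k hk) (mul_le_mul (h2 k hk) (h3 k hk) (hp2 k).le (by positivity))
          (mul_pos (hp1 k) (hp2 k)).le (by positivity)
    _ = _ := by ring

theorem hasSum_saalSeries_threeTwo {a b c d e f g : ℝ} (ha : 0 < a) (hb : 0 < b) (hc : 0 < c)
    (hd : 0 < d) (he : 0 < e) (hdf : d < f) (hdg : d < g)
    (hs : e + f + g = a + b + c + d + 1) (hC : 0 < a + b + 1 - e) :
    HasSum (fun n : ℕ => Real.Gamma (n + (f - d)) * Real.Gamma (n + (g - d)) / n.factorial *
      threeTwo a b c e (n + (a + b + 1 - e)))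
      (Real.Gamma (f - d) * Real.Gamma (g - d) * saalSeries a b c d e f g) := by
  have hA : 0 < f - d := by linarith
  have hB : 0 < g - d := by linarith
  have hCe : a + b + 1 - e = f + g - c - d := by linarith
  set C := a + b + 1 - e with hCdef
  let u : ℕ × ℕ → ℝ := fun x =>
    gaussTerm a b e x.1 * Real.Gamma (x.1 + c) * gaussTerm (f - d) (g - d) (x.1 + (c + C)) x.2
  have hu0 : ∀ x, 0 ≤ u x := fun x =>
    mul_nonneg (mul_nonneg (gaussTerm_pos ha hb he _).le (Gamma_natCast_add_pos hc _).le)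
      (gaussTerm_pos hA hB (by positivity) _).le
  have hs1 : ∀ k : ℕ, Summable fun n => u (k, n) := fun k => by
    have hk0 : (0 : ℝ) ≤ k := by positivity
    have hlt : f - d + (g - d) < k + (c + C) := by linarith
    exact (summable_gaussTerm hA hB hlt).mul_left (gaussTerm a b e k * Real.Gamma (k + c))
  have ht1 : ∀ k : ℕ, ∑' n, u (k, n) = Real.Gamma (f - d) * Real.Gamma (g - d) *
      (gaussTerm a b e k * (Real.Gamma (k + c) * Real.Gamma (k + d) /
        (Real.Gamma (k + f) * Real.Gamma (k + g)))) := fun k => by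
    have hk0 : (0 : ℝ) ≤ k := by positivity
    simp only [u]
    rw [tsum_mul_left, tsum_gaussTerm hA hB (by linarith),
      show (k : ℝ) + (c + C) - (f - d) - (g - d) = k + d by linarith,
      show (k : ℝ) + (c + C) - (f - d) = k + g by linarith,
      show (k : ℝ) + (c + C) - (g - d) = k + f by linarith]
    ring
  have hsu : Summable u := by
    rw [summable_prod_of_nonneg hu0]
    refine ⟨hs1, ?_⟩
    simp_rw [ht1]
    exact (summable_saalSeries ha hb hc hd he (by linarith) (by linarith) hs).mul_left _
  have hval : ∑' x, u x = Real.Gamma (f - d) * Real.Gamma (g - d) * saalSeries a b c d e f g := by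
    rw [hsu.tsum_prod, saalSeries, ← tsum_mul_left]
    exact tsum_congr ht1
  have hsw : HasSum (fun x : ℕ × ℕ => u x.swap) (∑' x, u x) :=
    (Equiv.prodComm ℕ ℕ).hasSum_iff.2 hsu.hasSum
  rw [← hval]
  refine (hsw.prod_fiberwise fun n => (hsw.summable.prod_factor n).hasSum).congr_fun fun n => ?_
  rw [threeTwo, ← tsum_mul_left]
  refine tsum_congr fun k => ?_
  simp only [u, Prod.swap, gaussTerm]
  rw [show (k : ℝ) + (c + (n + C)) = n + (k + (c + C)) by ring]
  ring

/-- The symmetric double series. -/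
def symmSeries (a b A B C c : ℝ) : ℝ :=
  ∑' n : ℕ, gaussTerm A B C n * threeTwo a b (n + C) C c

theorem saalSeries_sub_eq_symmSeries {a b c d e f g : ℝ} (ha : 0 < a) (hb : 0 < b) (hc : 0 < c)
    (hd : 0 < d) (ha' : 0 < 1 + a - e) (hb' : 0 < 1 + b - e) (hc' : 0 < 1 + c - e)
    (hd' : 0 < 1 + d - e) (hdf : d < f) (hdg : d < g)
    (hs : e + f + g = a + b + c + d + 1) (habe : a + b < e) (hsin : Real.sin (Real.pi * e) ≠ 0) :
    Real.Gamma (f - d) * Real.Gamma (g - d) * (saalSeries a b c d e f g -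
      saalSeries (1 + a - e) (1 + b - e) (1 + c - e) (1 + d - e) (2 - e) (1 + f - e) (1 + g - e)) =
    Real.sin (Real.pi * e) / Real.pi * (Real.Gamma (1 + a - e) * Real.Gamma (1 + b - e)) *
      (Real.Gamma c * symmSeries a b (f - d) (g - d) (a + b + 1 - e) c) ∧
    Summable fun n : ℕ => gaussTerm (f - d) (g - d) (a + b + 1 - e) n *
      threeTwo a b (n + (a + b + 1 - e)) (a + b + 1 - e) c := by
  have hC : 0 < a + b + 1 - e := by linarith
  have h1 := hasSum_saalSeries_threeTwo ha hb hc hd (by linarith) hdf hdg hs hC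
  have h2 := hasSum_saalSeries_threeTwo (f := 1 + f - e) (g := 1 + g - e) ha' hb' hc' hd'
    (by linarith : 0 < 2 - e) (by linarith) (by linarith) (by linarith) (by linarith)
  rw [show 1 + a - e + (1 + b - e) + 1 - (2 - e) = a + b + 1 - e by ring,
    show 1 + f - e - (1 + d - e) = f - d by ring,
    show 1 + g - e - (1 + d - e) = g - d by ring] at h2
  have h3 := h1.sub h2
  have h4 : ∀ n : ℕ, Real.Gamma (n + (f - d)) * Real.Gamma (n + (g - d)) / n.factorial *
      threeTwo a b c e (n + (a + b + 1 - e)) - Real.Gamma (n + (f - d)) *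
      Real.Gamma (n + (g - d)) / n.factorial *
      threeTwo (1 + a - e) (1 + b - e) (1 + c - e) (2 - e) (n + (a + b + 1 - e)) =
      Real.sin (Real.pi * e) / Real.pi * (Real.Gamma (1 + a - e) * Real.Gamma (1 + b - e)) *
      (Real.Gamma c * (gaussTerm (f - d) (g - d) (a + b + 1 - e) n *
        threeTwo a b (n + (a + b + 1 - e)) (a + b + 1 - e) c)) := fun n => by
    have h5 := threeTwoPair_eq ha hb habe ha' hb' n c hc hc'
    rw [← mul_sub, ← threeTwoPair, h5, gaussTerm]
    ring
  simp_rw [h4] at h3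
  have hne : Real.sin (Real.pi * e) / Real.pi * (Real.Gamma (1 + a - e) * Real.Gamma (1 + b - e))
      ≠ 0 := by
    have := Real.Gamma_pos_of_pos ha'
    have := Real.Gamma_pos_of_pos hb'
    have := Real.pi_pos
    positivity
  have hne' : Real.Gamma c ≠ 0 := (Real.Gamma_pos_of_pos hc).ne'
  refine ⟨?_, ?_⟩
  · rw [symmSeries, ← tsum_mul_left, ← tsum_mul_left, mul_sub, h3.tsum_eq]
  · have h6 := h3.summable
    rwa [summable_mul_left_iff hne, summable_mul_left_iff hne'] at h6

theorem symmSeries_comm {a b A B C c : ℝ} (ha : 0 < a) (hb : 0 < b) (hA : 0 < A) (hB : 0 < B)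
    (hC : 0 < C) (hc : 0 < c) (hs : a + b < C + c)
    (h : Summable fun n : ℕ => gaussTerm A B C n * threeTwo a b (n + C) C c) :
    symmSeries a b A B C c = symmSeries A B a b C c := by
  let u : ℕ × ℕ → ℝ := fun x => gaussTerm A B C x.1 * (gaussTerm a b C x.2 *
    (Real.Gamma (x.2 + (x.1 + C)) / Real.Gamma (x.2 + (x.1 + C + c))))
  have hu0 : ∀ x, 0 ≤ u x := fun x =>
    mul_nonneg (gaussTerm_pos hA hB hC _).le (mul_nonneg (gaussTerm_pos ha hb hC _).le
      (div_pos (Gamma_natCast_add_pos (by positivity) _)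
        (Gamma_natCast_add_pos (by positivity) _)).le)
  have hu : Summable u := by
    rw [summable_prod_of_nonneg hu0]
    refine ⟨fun n => ?_, h.congr fun n => ?_⟩
    · have hn : 0 < (n : ℝ) + C := by positivity
      exact (summable_threeTwo ha hb hn hC hc hs).mul_left (gaussTerm A B C n)
    · simp only [u]
      rw [tsum_mul_left, threeTwo]
  have h1 := Summable.tsum_comm (f := fun n m => u (n, m)) hu
  have h2 : ∀ n, ∑' m, u (n, m) = gaussTerm A B C n * threeTwo a b (n + C) C c := fun n => by
    simp only [u]
    rw [tsum_mul_left, threeTwo]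
  have h3 : ∀ m, ∑' n, u (n, m) = gaussTerm a b C m * threeTwo A B (m + C) C c := fun m => by
    rw [threeTwo, ← tsum_mul_left]
    refine tsum_congr fun n => ?_
    simp only [u]
    rw [show (m : ℝ) + (n + C) = n + (m + C) by ring,
      show (m : ℝ) + (n + C + c) = n + (m + C + c) by ring]
    ring
  simp_rw [h2, h3] at h1
  exact h1.symm

/-- The difference of a real Saalschützian series and its companion. -/
def saalPair (a b c d e f g : ℝ) : ℝ := saalSeries a b c d e f g -
  saalSeries (1 + a - e) (1 + b - e) (1 + c - e) (1 + d - e) (2 - e) (1 + f - e) (1 + g - e)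

theorem saalPair_transform {a b c d e f g : ℝ} (ha : 0 < a) (hb : 0 < b) (hc : 0 < c)
    (hd : 0 < d) (ha' : 0 < 1 + a - e) (hb' : 0 < 1 + b - e) (hc' : 0 < 1 + c - e)
    (hd' : 0 < 1 + d - e) (hdf : d < f) (hdg : d < g) (hcf : c < f) (hcg : c < g)
    (hs : e + f + g = a + b + c + d + 1) (habe : a + b < e) (hsin : Real.sin (Real.pi * e) ≠ 0)
    (hsin' : Real.sin (Real.pi * (1 + c - d)) ≠ 0) :
    Real.sin (Real.pi * (1 + c - d)) * (Real.Gamma (f - c) * Real.Gamma (g - c) *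
      Real.Gamma (f - d) * Real.Gamma (g - d)) * saalPair a b c d e f g =
    Real.sin (Real.pi * e) * (Real.Gamma (1 + a - e) * Real.Gamma (1 + b - e) *
      Real.Gamma a * Real.Gamma b) *
      saalPair (f - d) (g - d) c (1 + c - e) (1 + c - d) (1 + a + c - e) (1 + b + c - e) := by
  obtain ⟨h1, h2⟩ := saalSeries_sub_eq_symmSeries ha hb hc hd ha' hb' hc' hd' hdf hdg hs habe hsin
  obtain ⟨h3, -⟩ := saalSeries_sub_eq_symmSeries (a := f - d) (b := g - d) (c := c)
    (d := 1 + c - e) (e := 1 + c - d) (f := 1 + a + c - e) (g := 1 + b + c - e)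
    (by linarith) (by linarith) hc hc' (by linarith) (by linarith) (by linarith) (by linarith)
    (by linarith) (by linarith) (by linarith) (by linarith) hsin'
  have h4 := symmSeries_comm ha hb (by linarith) (by linarith) (by linarith) hc (by linarith) h2
  rw [show f - d + (g - d) + 1 - (1 + c - d) = a + b + 1 - e by linarith,
    show 1 + a + c - e - (1 + c - e) = a by ring, show 1 + b + c - e - (1 + c - e) = b by ring,
    show 1 + (f - d) - (1 + c - d) = f - c by ring,
    show 1 + (g - d) - (1 + c - d) = g - c by ring, ← h4] at h3
  rw [← saalPair] at h1
  have h3' : Real.Gamma a * Real.Gamma b *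
      saalPair (f - d) (g - d) c (1 + c - e) (1 + c - d) (1 + a + c - e) (1 + b + c - e) =
      Real.sin (Real.pi * (1 + c - d)) / Real.pi * (Real.Gamma (f - c) * Real.Gamma (g - c)) *
      (Real.Gamma c * symmSeries a b (f - d) (g - d) (a + b + 1 - e) c) := by
    rw [saalPair, show 1 + (f - d) - (1 + c - d) = f - c by ring,
      show 1 + (g - d) - (1 + c - d) = g - c by ring]
    exact h3
  linear_combination (Real.sin (Real.pi * (1 + c - d)) * Real.Gamma (f - c) *
    Real.Gamma (g - c)) * h1 - Real.sin (Real.pi * e) *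
    (Real.Gamma (1 + a - e) * Real.Gamma (1 + b - e)) * h3'

theorem saalSeries_perm (a b c d e f g : ℝ) :
    saalSeries a b c d e f g = saalSeries c d a b e f g := by
  refine tsum_congr fun k => ?_
  unfold gaussTerm
  ring

theorem saalPair_perm (a b c d e f g : ℝ) : saalPair a b c d e f g = saalPair c d a b e f g := by
  unfold saalPair
  rw [saalSeries_perm a, saalSeries_perm (1 + a - e)]

theorem saalPair_transform_transform {a b c d e f g : ℝ} (ha : 0 < a) (hb : 0 < b) (hc : 0 < c)
    (hd : 0 < d) (ha' : 0 < 1 + a - e) (hb' : 0 < 1 + b - e) (hc' : 0 < 1 + c - e)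
    (hd' : 0 < 1 + d - e) (haf : a < f) (hag : a < g) (hbf : b < f) (hbg : b < g)
    (hdf : d < f) (hdg : d < g) (hcf : c < f) (hcg : c < g)
    (hs : e + f + g = a + b + c + d + 1) (habe : a + b < e) (hcde : c + d < e)
    (hsin : Real.sin (Real.pi * e) ≠ 0)
    (hsin' : Real.sin (Real.pi * (1 + c - d)) ≠ 0)
    (hsin'' : Real.sin (Real.pi * (1 + f - g)) ≠ 0) :
    Real.sin (Real.pi * (1 + f - g)) * (Real.Gamma (f - a) * Real.Gamma (f - b) *
      Real.Gamma (f - c) * Real.Gamma (f - d) * (Real.Gamma (g - a) * Real.Gamma (g - b) *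
      Real.Gamma (g - c) * Real.Gamma (g - d))) * saalPair a b c d e f g =
    Real.sin (Real.pi * e) * (Real.Gamma a * Real.Gamma b * Real.Gamma c * Real.Gamma d *
      (Real.Gamma (1 + a - e) * Real.Gamma (1 + b - e) * Real.Gamma (1 + c - e) *
      Real.Gamma (1 + d - e))) *
      saalPair (f - b) (f - a) (f - d) (f - c) (1 + f - g) f (1 + f - e) := by
  have h1 := saalPair_transform ha hb hc hd ha' hb' hc' hd' hdf hdg hcf hcg hs habe hsin hsin'
  have h2 := saalPair_transform (a := c) (b := 1 + c - e) (c := f - d) (d := g - d)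
    (e := 1 + c - d) (f := 1 + a + c - e) (g := 1 + b + c - e)
    (by linarith) (by linarith) (by linarith) (by linarith) (by linarith) (by linarith)
    (by linarith) (by linarith) (by linarith) (by linarith) (by linarith) (by linarith)
    (by linarith) (by linarith) hsin' (by rwa [show 1 + (f - d) - (g - d) = 1 + f - g by ring])
  rw [show 1 + (f - d) - (g - d) = 1 + f - g by ring,
    show 1 + a + c - e - (f - d) = g - b by linarith,
    show 1 + b + c - e - (f - d) = g - a by linarith,
    show 1 + a + c - e - (g - d) = f - b by linarith,
    show 1 + b + c - e - (g - d) = f - a by linarith,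
    show 1 + c - (1 + c - d) = d by ring,
    show 1 + (1 + c - e) - (1 + c - d) = 1 + d - e by ring,
    show 1 + (f - d) - (1 + c - d) = f - c by ring,
    show 1 + c + (f - d) - (1 + c - d) = f by ring,
    show 1 + (1 + c - e) + (f - d) - (1 + c - d) = 1 + f - e by ring,
    ← saalPair_perm (f - d)] at h2
  refine mul_left_cancel₀ hsin' ?_
  linear_combination (Real.sin (Real.pi * (1 + f - g)) * Real.Gamma (f - a) * Real.Gamma (f - b) *
    Real.Gamma (g - a) * Real.Gamma (g - b)) * h1 + (Real.sin (Real.pi * e) *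
    Real.Gamma (1 + a - e) * Real.Gamma (1 + b - e) * Real.Gamma a * Real.Gamma b) * h2

theorem exists_norm_prod_one_add_mul_sub_le {ι : Type*} (s : Finset ι) {R : ℝ} (hR : 0 ≤ R) :
    ∃ C : ℝ, 0 ≤ C ∧ ∀ (x : ι → ℂ) (t : ℂ), (∀ i, ‖x i‖ ≤ R) → ‖t‖ ≤ 1 →
      ‖∏ i ∈ s, (1 + t * x i) - 1 - t * ∑ i ∈ s, x i‖ ≤ C * ‖t‖ ^ 2 := by
  classical
  induction s using Finset.induction_on with
  | empty => exact ⟨0, le_rfl, fun x t _ _ => by simp⟩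
  | insert j s hj ih =>
    obtain ⟨C, hC, h⟩ := ih
    refine ⟨C * (1 + R) + R * (s.card * R), by positivity, fun x t hx ht => ?_⟩
    rw [Finset.prod_insert hj, Finset.sum_insert hj]
    have h1 : ‖∑ i ∈ s, x i‖ ≤ s.card * R := by
      simpa using norm_sum_le_of_le s fun i _ => hx i
    have h2 : ‖1 + t * x j‖ ≤ 1 + R := by
      refine (norm_add_le _ _).trans ?_
      rw [norm_one, norm_mul]
      nlinarith [hx j, norm_nonneg t, norm_nonneg (x j)]
    calc _ = ‖(∏ i ∈ s, (1 + t * x i) - 1 - t * ∑ i ∈ s, x i) * (1 + t * x j) +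
          t ^ 2 * (x j * ∑ i ∈ s, x i)‖ := by ring_nf
      _ ≤ C * ‖t‖ ^ 2 * (1 + R) + ‖t‖ ^ 2 * (R * (s.card * R)) := by
        refine (norm_add_le _ _).trans (add_le_add ?_ ?_)
        · rw [norm_mul]
          exact mul_le_mul (h x t hx ht) h2 (norm_nonneg _) (by positivity)
        · rw [norm_mul, norm_mul, norm_pow]
          exact mul_le_mul_of_nonneg_left (mul_le_mul (hx j) h1 (norm_nonneg _) hR) (by positivity)
      _ = _ := by ring

theorem exists_norm_prod_add_div_prod_add_le (ι : Type*) [Fintype ι] {R : ℝ} (hR : 1 ≤ R) :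
    ∃ C : ℝ, 0 ≤ C ∧ ∀ (a b : ι → ℂ) (w : ℂ), (∀ i, ‖a i‖ ≤ R) → (∀ i, ‖b i‖ ≤ R) →
      ∑ i, a i = ∑ i, b i → 2 * R ≤ ‖w‖ →
      ‖(∏ i, (w + b i)) / ∏ i, (w + a i)‖ ≤ 1 + C * (‖w‖ ^ 2)⁻¹ := by
  obtain ⟨C, hC, h⟩ := exists_norm_prod_one_add_mul_sub_le (Finset.univ : Finset ι)
    (by linarith : 0 ≤ R)
  refine ⟨2 * C * 2 ^ Fintype.card ι, by positivity, fun a b w ha hb hab hw => ?_⟩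
  have hw0 : 0 < ‖w‖ := by linarith
  have hw0' : w ≠ 0 := norm_pos_iff.1 hw0
  have ht : ‖w⁻¹‖ ≤ 1 := by
    rw [norm_inv]
    exact inv_le_one_of_one_le₀ (by linarith)
  have hfac : ∀ x : ι → ℂ, ∏ i, (w + x i) = w ^ Fintype.card ι * ∏ i, (1 + w⁻¹ * x i) := fun x => by
    rw [← Finset.card_univ, ← Finset.prod_const, ← Finset.prod_mul_distrib]
    refine Finset.prod_congr rfl fun i _ => ?_
    field_simp
  rw [hfac, hfac, mul_div_mul_left _ _ (pow_ne_zero _ hw0')]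
  have hlow : (1 / 2 : ℝ) ^ Fintype.card ι ≤ ‖∏ i, (1 + w⁻¹ * a i)‖ := by
    rw [norm_prod, ← Finset.card_univ, ← Finset.prod_const]
    refine Finset.prod_le_prod (fun _ _ => by norm_num) fun i _ => ?_
    have h1 : ‖w⁻¹ * a i‖ ≤ 1 / 2 := by
      rw [norm_mul, norm_inv, inv_mul_le_iff₀ hw0]
      linarith [ha i]
    have h2 := norm_sub_le (1 + w⁻¹ * a i) (w⁻¹ * a i)
    rw [add_sub_cancel_right, norm_one] at h2
    linarith
  have hne : 0 < ‖∏ i, (1 + w⁻¹ * a i)‖ := lt_of_lt_of_le (by positivity) hlow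
  have hdiff : ‖∏ i, (1 + w⁻¹ * b i) - ∏ i, (1 + w⁻¹ * a i)‖ ≤ 2 * C * ‖w⁻¹‖ ^ 2 := by
    have h1 := h a w⁻¹ ha ht
    have h2 := h b w⁻¹ hb ht
    calc _ = ‖(∏ i, (1 + w⁻¹ * b i) - 1 - w⁻¹ * ∑ i, b i) -
        (∏ i, (1 + w⁻¹ * a i) - 1 - w⁻¹ * ∑ i, a i)‖ := by rw [hab]; ring_nf
      _ ≤ _ := (norm_sub_le _ _).trans (by linarith)
  rw [norm_div, div_le_iff₀ hne]
  have h3 : ‖∏ i, (1 + w⁻¹ * b i)‖ ≤ ‖∏ i, (1 + w⁻¹ * a i)‖ + 2 * C * ‖w⁻¹‖ ^ 2 := by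
    have := norm_le_norm_add_norm_sub' (∏ i, (1 + w⁻¹ * b i)) (∏ i, (1 + w⁻¹ * a i))
    linarith
  rw [norm_inv, inv_pow] at h3
  have h4 : (1 : ℝ) ≤ 2 ^ Fintype.card ι * ‖∏ i, (1 + w⁻¹ * a i)‖ := by
    calc (1 : ℝ) = 2 ^ Fintype.card ι * (1 / 2 : ℝ) ^ Fintype.card ι := by
          rw [← mul_pow]; norm_num
      _ ≤ _ := by gcongr
  have h5 : 0 ≤ 2 * C * (‖w‖ ^ 2)⁻¹ := by positivity
  nlinarith

theorem summable_one_div_one_add_int_sq : Summable fun k : ℤ => 1 / (1 + (k : ℝ) ^ 2) := by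
  have h := (Real.summable_one_div_int_pow (p := 2)).2 (by norm_num)
  refine Summable.of_norm_bounded_eventually h ?_
  filter_upwards [(Set.finite_singleton (0 : ℤ)).compl_mem_cofinite] with k hk
  have hk' : (k : ℝ) ≠ 0 := by simpa using hk
  rw [Real.norm_of_nonneg (by positivity)]
  exact one_div_le_one_div_of_le (by positivity) (by linarith)

theorem exists_sum_inv_norm_add_sq_le : ∃ S : ℝ, 0 ≤ S ∧ ∀ z : ℂ, (∀ k : ℕ, 1 ≤ ‖z + k‖) →
    ∀ n : ℕ, ∑ j ∈ Finset.range n, (‖z + j‖ ^ 2)⁻¹ ≤ S := by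
  refine ⟨6 * ∑' k : ℤ, 1 / (1 + (k : ℝ) ^ 2), by positivity, fun z hz n => ?_⟩
  have hinj : Function.Injective fun j : ℕ => (j : ℤ) + ⌊z.re⌋ := fun i j h => by simpa using h
  have hs := summable_one_div_one_add_int_sq.comp_injective hinj
  have hle : ∑' j : ℕ, ((fun k : ℤ => 1 / (1 + (k : ℝ) ^ 2)) ∘ fun j : ℕ => (j : ℤ) + ⌊z.re⌋) j ≤
      ∑' k : ℤ, 1 / (1 + (k : ℝ) ^ 2) :=
    tsum_comp_le_tsum_of_inj summable_one_div_one_add_int_sq (fun _ => by positivity) hinj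
  have h2 := (hs.sum_le_tsum (Finset.range n) fun _ _ => by simp only [Function.comp]; positivity).trans hle
  refine le_trans ?_ (mul_le_mul_of_nonneg_left h2 (by norm_num : (0 : ℝ) ≤ 6))
  rw [Finset.mul_sum]
  refine Finset.sum_le_sum fun j _ => ?_
  have h3 := hz j
  have h4 : (z.re + j) ^ 2 ≤ ‖z + j‖ ^ 2 := by
    rw [← Complex.normSq_eq_norm_sq, Complex.normSq_apply]
    simp
    nlinarith [mul_self_nonneg z.im]
  have h5 := Int.floor_le z.re
  have h6 := Int.lt_floor_add_one z.re
  have h7 : (0 : ℝ) < ‖z + j‖ ^ 2 := by positivity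
  simp only [Function.comp]
  push_cast
  rw [mul_one_div, inv_eq_one_div, div_le_div_iff₀ h7 (by positivity), one_mul]
  have h8 : ((j : ℝ) + ⌊z.re⌋) ^ 2 ≤ 2 * (z.re + j) ^ 2 + 2 := by
    have h9 : 0 ≤ z.re - ⌊z.re⌋ := by linarith
    have h10 : z.re - ⌊z.re⌋ ≤ 1 := by linarith
    nlinarith [sq_nonneg ((z.re + j) + (z.re - ⌊z.re⌋))]
  nlinarith

open Filter Topology in
theorem exists_norm_prod_Gamma_div_le (ι : Type*) [Fintype ι] {R : ℝ} (hR : 1 ≤ R) :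
    ∃ M : ℝ, 0 ≤ M ∧ ∀ (a b : ι → ℂ) (z : ℂ), (∀ i, ‖a i‖ ≤ R) → (∀ i, ‖b i‖ ≤ R) →
      ∑ i, a i = ∑ i, b i → (∀ k : ℕ, 2 * R ≤ ‖z + k‖) →
      ‖∏ i, (Gamma (z + a i) / Gamma (z + b i))‖ ≤ M := by
  obtain ⟨C, hC, h⟩ := exists_norm_prod_add_div_prod_add_le ι hR
  obtain ⟨S, hS, hsum⟩ := exists_sum_inv_norm_add_sq_le
  refine ⟨Real.exp (C * S), (Real.exp_pos _).le, fun a b z ha hb hab hz => ?_⟩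
  have hne : ∀ x : ι → ℂ, (∀ i, ‖x i‖ ≤ R) → ∀ i, ∀ k : ℕ, z + x i + k ≠ 0 := by
    intro x hx i k h0
    have h1 : z + k = -x i := by linear_combination h0
    have h2 := hz k
    rw [h1, norm_neg] at h2
    linarith [hx i]
  have hlim : Tendsto (fun n : ℕ => ∏ i, (GammaSeq (z + a i) n / GammaSeq (z + b i) n)) atTop
      (𝓝 (∏ i, (Gamma (z + a i) / Gamma (z + b i)))) := by
    refine tendsto_finsetProd _ fun i _ => ?_
    refine (GammaSeq_tendsto_Gamma _).div (GammaSeq_tendsto_Gamma _) (Gamma_ne_zero fun m hm => ?_)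
    exact hne b hb i m (by rw [hm]; ring)
  refine le_of_tendsto hlim.norm ?_
  filter_upwards [eventually_ge_atTop 1] with n hn
  have hn0 : (n : ℂ) ≠ 0 := by exact_mod_cast (by omega : n ≠ 0)
  have hq : ∏ i, (GammaSeq (z + a i) n / GammaSeq (z + b i) n) =
      ∏ j ∈ Finset.range (n + 1), ((∏ i, (z + j + b i)) / ∏ i, (z + j + a i)) := by
    have h1 : ∀ i, GammaSeq (z + a i) n / GammaSeq (z + b i) n = (n : ℂ) ^ (a i - b i) *
        ∏ j ∈ Finset.range (n + 1), ((z + j + b i) / (z + j + a i)) := fun i => by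
      have hf : (n.factorial : ℂ) ≠ 0 := by exact_mod_cast n.factorial_ne_zero
      have hpa : ∏ j ∈ Finset.range (n + 1), (z + a i + j) ≠ 0 :=
        Finset.prod_ne_zero_iff.2 fun j _ => hne a ha i j
      have hpb : ∏ j ∈ Finset.range (n + 1), (z + b i + j) ≠ 0 :=
        Finset.prod_ne_zero_iff.2 fun j _ => hne b hb i j
      have hc : (n : ℂ) ^ (z + b i) ≠ 0 := by simp [Complex.cpow_eq_zero_iff, hn0]
      rw [Finset.prod_div_distrib, GammaSeq, GammaSeq,
        show a i - b i = (z + a i) - (z + b i) by ring, Complex.cpow_sub _ _ hn0]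
      simp_rw [add_right_comm z _ (b i), add_right_comm z _ (a i)]
      field_simp
    simp_rw [h1]
    have h2 : ∏ i, (n : ℂ) ^ (a i - b i) = 1 := by
      simp_rw [Complex.cpow_def_of_ne_zero hn0]
      rw [← Complex.exp_sum, ← Finset.mul_sum, Finset.sum_sub_distrib, hab, sub_self, mul_zero,
        Complex.exp_zero]
    rw [Finset.prod_mul_distrib, h2, one_mul, Finset.prod_comm]
    exact Finset.prod_congr rfl fun j _ => Finset.prod_div_distrib _ _
  rw [hq, norm_prod]
  calc ∏ j ∈ Finset.range (n + 1), ‖(∏ i, (z + j + b i)) / ∏ i, (z + j + a i)‖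
      ≤ ∏ j ∈ Finset.range (n + 1), Real.exp (C * (‖z + j‖ ^ 2)⁻¹) := by
        refine Finset.prod_le_prod (fun _ _ => norm_nonneg _) fun j _ => ?_
        refine (h a b (z + j) ha hb hab (hz j)).trans ?_
        rw [add_comm]
        exact Real.add_one_le_exp _
    _ = Real.exp (C * ∑ j ∈ Finset.range (n + 1), (‖z + j‖ ^ 2)⁻¹) := by
        rw [← Real.exp_sum, Finset.mul_sum]
    _ ≤ Real.exp (C * S) := Real.exp_le_exp.2
        (mul_le_mul_of_nonneg_left (hsum z (fun k => by linarith [hz k]) _) hC)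

theorem exists_norm_Gamma_quotient_le {R : ℝ} (hR : 1 ≤ R) :
    ∃ M : ℝ, 0 ≤ M ∧ ∀ a₁ a₂ a₃ a₄ b₁ b₂ b₃ b₄ z : ℂ, ‖a₁‖ ≤ R → ‖a₂‖ ≤ R → ‖a₃‖ ≤ R → ‖a₄‖ ≤ R →
      ‖b₁‖ ≤ R → ‖b₂‖ ≤ R → ‖b₃‖ ≤ R → ‖b₄‖ ≤ R → b₁ + b₂ + b₃ + b₄ = a₁ + a₂ + a₃ + a₄ + 2 →
      (∀ k : ℕ, 2 * R ≤ ‖z + k‖) →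
      ‖Gamma (z + a₁) * Gamma (z + a₂) * Gamma (z + a₃) * Gamma (z + a₄) /
        (Gamma (z + b₁) * Gamma (z + b₂) * Gamma (z + b₃) * Gamma (z + b₄))‖ ≤ M / ‖z‖ ^ 2 := by
  obtain ⟨M, hM, h⟩ := exists_norm_prod_Gamma_div_le (Fin 6) hR
  refine ⟨M, hM, fun a₁ a₂ a₃ a₄ b₁ b₂ b₃ b₄ z h1 h2 h3 h4 h5 h6 h7 h8 hs hz => ?_⟩
  have hz0 := hz 0
  rw [Nat.cast_zero, add_zero] at hz0
  have hzpos : 0 < ‖z‖ := by linarith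
  have hne : z ≠ 0 := norm_pos_iff.1 hzpos
  have hg : Gamma z ≠ 0 := Gamma_ne_zero fun m hm => by
    have := hz m
    rw [hm, neg_add_cancel, norm_zero] at this
    linarith
  have key := h ![a₁, a₂, a₃, a₄, 1, 1] ![b₁, b₂, b₃, b₄, 0, 0] z
    (fun i => by fin_cases i <;> simp [*]) (fun i => by fin_cases i <;> simp [*] <;> linarith)
    (by simp [Fin.sum_univ_succ]; linear_combination -hs) hz
  rw [le_div_iff₀ (by positivity), ← norm_pow, ← norm_mul]
  refine le_of_eq_of_le (congrArg norm ?_) key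
  simp [Fin.prod_univ_succ, Gamma_add_one z hne]
  field_simp

/-- The rising factorial `a (a+1) ⋯ (a+k-1)`. -/
def risingFactorial (a : ℂ) (k : ℕ) : ℂ := ∏ j ∈ Finset.range k, (a + j)

theorem risingFactorial_mul_Gamma {a : ℂ} {N : ℕ} (ha : 0 < (N + a).re) :
    ∀ k : ℕ, N ≤ k → risingFactorial a k * Gamma (N + a) = risingFactorial a N * Gamma (k + a) := by
  intro k hk
  induction k, hk using Nat.le_induction with
  | base => rfl
  | succ k hk ih =>
    have h0 : (k : ℂ) + a ≠ 0 := fun h => by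
      have h1 := congrArg Complex.re h
      have h2 : (N : ℝ) ≤ k := by exact_mod_cast hk
      simp at h1 ha
      linarith
    rw [risingFactorial, Finset.prod_range_succ, ← risingFactorial, mul_right_comm, ih]
    push_cast
    rw [show (k : ℂ) + 1 + a = k + a + 1 by ring, Gamma_add_one _ h0]
    ring

theorem Gamma_mul_risingFactorial {a : ℂ} (ha : ∀ m : ℕ, a ≠ -m) (k : ℕ) :
    Gamma a * risingFactorial a k = Gamma (k + a) := by
  induction k with
  | zero => simp [risingFactorial]
  | succ k ih =>
    have h0 : (k : ℂ) + a ≠ 0 := fun h => ha k (by linear_combination h)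
    rw [risingFactorial, Finset.prod_range_succ, ← risingFactorial, ← mul_assoc, ih]
    push_cast
    rw [show (k : ℂ) + 1 + a = k + a + 1 by ring, Gamma_add_one _ h0]
    ring

theorem differentiable_risingFactorial (k : ℕ) : Differentiable ℂ fun a => risingFactorial a k := by
  unfold risingFactorial
  fun_prop

/-- General term of the Saalschützian series, normalized to be entire in the parameters. -/
def entireTerm (a b c d e f g : ℂ) (k : ℕ) : ℂ :=
  risingFactorial a k * risingFactorial b k * risingFactorial c k * risingFactorial d k *
    ((k.factorial : ℂ)⁻¹ * (Gamma (k + e))⁻¹ * (Gamma (k + f))⁻¹ * (Gamma (k + g))⁻¹)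

/-- The Saalschützian series, normalized to be entire in the parameters. -/
def entireSeries (a b c d e f g : ℂ) : ℂ := ∑' k, entireTerm a b c d e f g k

theorem Fstar_eq_mul_entireSeries {a b c d : ℂ} (e f g : ℂ) (ha : ∀ m : ℕ, a ≠ -m)
    (hb : ∀ m : ℕ, b ≠ -m) (hc : ∀ m : ℕ, c ≠ -m) (hd : ∀ m : ℕ, d ≠ -m) :
    Fstar a b c d e f g = Gamma a * Gamma b * Gamma c * Gamma d * entireSeries a b c d e f g := by
  rw [Fstar, entireSeries, ← tsum_mul_left]
  refine tsum_congr fun k => ?_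
  rw [entireTerm, ← Gamma_mul_risingFactorial ha, ← Gamma_mul_risingFactorial hb,
    ← Gamma_mul_risingFactorial hc, ← Gamma_mul_risingFactorial hd, div_eq_mul_inv]
  simp only [mul_inv]
  ring

theorem exists_norm_entireTerm_le {R : ℝ} (hR : 1 ≤ R) :
    ∃ (N : ℕ) (M : ℝ), 0 ≤ M ∧ ∀ a b c d e f g : ℂ, ‖a‖ ≤ R → ‖b‖ ≤ R → ‖c‖ ≤ R → ‖d‖ ≤ R →
      ‖e‖ ≤ R → ‖f‖ ≤ R → ‖g‖ ≤ R → e + f + g = a + b + c + d + 1 → ∀ k : ℕ, N ≤ k →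
      ‖entireTerm a b c d e f g k‖ ≤
        ‖risingFactorial a N * (Gamma (N + a))⁻¹ * (risingFactorial b N * (Gamma (N + b))⁻¹) *
        (risingFactorial c N * (Gamma (N + c))⁻¹) * (risingFactorial d N * (Gamma (N + d))⁻¹)‖ *
        (M * (1 / (k : ℝ) ^ 2)) := by
  obtain ⟨M, hM, h⟩ := exists_norm_Gamma_quotient_le hR
  obtain ⟨N, hN⟩ := exists_nat_ge (2 * R)
  refine ⟨N, M, hM, fun a b c d e f g ha hb hc hd he hf hg hs k hk => ?_⟩
  have hpos : ∀ x : ℂ, ‖x‖ ≤ R → 0 < (N + x).re := fun x hx => by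
    have := (abs_le.1 (Complex.abs_re_le_norm x)).1
    simp
    linarith
  have hrf : ∀ x : ℂ, ‖x‖ ≤ R →
      risingFactorial x k = risingFactorial x N * (Gamma (N + x))⁻¹ * Gamma (k + x) := fun x hx => by
    have h1 := risingFactorial_mul_Gamma (hpos x hx) k hk
    have h2 := Gamma_ne_zero_of_re_pos (hpos x hx)
    field_simp
    linear_combination h1
  have hNk : (N : ℝ) ≤ k := by exact_mod_cast hk
  have key := h a b c d 1 e f g k ha hb hc hd (by simpa using hR) he hf hg
    (by linear_combination hs) (fun j => by
      rw [← Nat.cast_add, Complex.norm_natCast]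
      push_cast
      linarith [(Nat.cast_nonneg j : (0 : ℝ) ≤ j)])
  rw [Complex.norm_natCast, Gamma_nat_eq_factorial, div_eq_mul_one_div M] at key
  refine le_trans (le_of_eq ?_) (mul_le_mul_of_nonneg_left key (norm_nonneg _))
  rw [← norm_mul, entireTerm, hrf a ha, hrf b hb, hrf c hc, hrf d hd, div_eq_mul_inv]
  simp only [mul_inv]
  ring_nf

theorem differentiable_entireTerm {a b c d e f g : ℂ → ℂ} (ha : Differentiable ℂ a)
    (hb : Differentiable ℂ b) (hc : Differentiable ℂ c) (hd : Differentiable ℂ d)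
    (he : Differentiable ℂ e) (hf : Differentiable ℂ f) (hg : Differentiable ℂ g) (k : ℕ) :
    Differentiable ℂ fun z => entireTerm (a z) (b z) (c z) (d z) (e z) (f z) (g z) k := by
  have hr : ∀ {x : ℂ → ℂ}, Differentiable ℂ x → Differentiable ℂ fun z => risingFactorial (x z) k :=
    fun hx => (differentiable_risingFactorial k).comp hx
  have hG : ∀ {x : ℂ → ℂ}, Differentiable ℂ x → Differentiable ℂ fun z => (Gamma (k + x z))⁻¹ :=
    fun hx => differentiable_one_div_Gamma.comp (hx.const_add (k : ℂ))
  exact (((hr ha).mul (hr hb)).mul (hr hc)).mul (hr hd) |>.mul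
    ((((differentiable_const _).mul (hG he)).mul (hG hf)).mul (hG hg))

theorem differentiable_entireSeries {a b c d e f g : ℂ → ℂ} (ha : Differentiable ℂ a)
    (hb : Differentiable ℂ b) (hc : Differentiable ℂ c) (hd : Differentiable ℂ d)
    (he : Differentiable ℂ e) (hf : Differentiable ℂ f) (hg : Differentiable ℂ g)
    (hs : ∀ z, e z + f z + g z = a z + b z + c z + d z + 1) :
    Differentiable ℂ fun z => entireSeries (a z) (b z) (c z) (d z) (e z) (f z) (g z) := by
  intro z₀
  have hbd : ∀ x : ℂ → ℂ, Continuous x → ∃ B, ∀ z ∈ Metric.closedBall z₀ 1, ‖x z‖ ≤ B := fun x hx =>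
    (isCompact_closedBall z₀ 1).exists_bound_of_continuousOn hx.continuousOn
  obtain ⟨Ra, hRa⟩ := hbd a ha.continuous
  obtain ⟨Rb, hRb⟩ := hbd b hb.continuous
  obtain ⟨Rc, hRc⟩ := hbd c hc.continuous
  obtain ⟨Rd, hRd⟩ := hbd d hd.continuous
  obtain ⟨Re, hRe⟩ := hbd e he.continuous
  obtain ⟨Rf, hRf⟩ := hbd f hf.continuous
  obtain ⟨Rg, hRg⟩ := hbd g hg.continuous
  obtain ⟨N, M, hM, h⟩ := exists_norm_entireTerm_le
    (R := 1 + |Ra| + |Rb| + |Rc| + |Rd| + |Re| + |Rf| + |Rg|) (by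
      have := abs_nonneg Ra; have := abs_nonneg Rb; have := abs_nonneg Rc; have := abs_nonneg Rd
      have := abs_nonneg Re; have := abs_nonneg Rf; have := abs_nonneg Rg
      linarith)
  have hdt := differentiable_entireTerm ha hb hc hd he hf hg
  have hpre : ∀ x : ℂ → ℂ, Differentiable ℂ x →
      Continuous fun z => risingFactorial (x z) N * (Gamma (N + x z))⁻¹ := fun x hx =>
    (((differentiable_risingFactorial N).comp hx).mul
      (differentiable_one_div_Gamma.comp (hx.const_add (N : ℂ)))).continuous
  obtain ⟨P, hP⟩ := hbd _ ((((hpre a ha).mul (hpre b hb)).mul (hpre c hc)).mul (hpre d hd))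
  choose B hB using fun k : ℕ => hbd _ (hdt k).continuous
  have hu : Summable fun k : ℕ => if N ≤ k then P * (M * (1 / (k : ℝ) ^ 2)) else B k := by
    refine Summable.congr_atTop (f₁ := fun k : ℕ => P * (M * (1 / (k : ℝ) ^ 2)))
      (((Real.summable_one_div_nat_pow.2 one_lt_two).mul_left M).mul_left _) ?_
    filter_upwards [Filter.eventually_ge_atTop N] with k hk
    rw [if_pos hk]
  have key := differentiableOn_tsum_of_summable_norm (U := Metric.ball z₀ 1)
    (F := fun (k : ℕ) z => entireTerm (a z) (b z) (c z) (d z) (e z) (f z) (g z) k) hu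
    (fun k => (hdt k).differentiableOn) Metric.isOpen_ball (fun k z hz => ?_)
  · exact key.differentiableAt (Metric.ball_mem_nhds z₀ one_pos)
  · have hz' := Metric.ball_subset_closedBall hz
    split_ifs with hk
    · have h1 := le_abs_self Ra
      have h2 := le_abs_self Rb
      have h3 := le_abs_self Rc
      have h4 := le_abs_self Rd
      have h5 := le_abs_self Re
      have h6 := le_abs_self Rf
      have h7 := le_abs_self Rg
      have g1 := abs_nonneg Ra
      have g2 := abs_nonneg Rb
      have g3 := abs_nonneg Rc
      have g4 := abs_nonneg Rd
      have g5 := abs_nonneg Re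
      have g6 := abs_nonneg Rf
      have g7 := abs_nonneg Rg
      refine (h (a z) (b z) (c z) (d z) (e z) (f z) (g z) ?_ ?_ ?_ ?_ ?_ ?_ ?_ (hs z) k hk).trans
        (mul_le_mul_of_nonneg_right (hP z hz') (by positivity))
      · linarith [hRa z hz']
      · linarith [hRb z hz']
      · linarith [hRc z hz']
      · linarith [hRd z hz']
      · linarith [hRe z hz']
      · linarith [hRf z hz']
      · linarith [hRg z hz']
    · exact hB k z hz'

/-- The difference of the entire Saalschützian series and its companion. -/
def entirePair (a b c d e f g : ℂ) : ℂ :=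
  entireSeries a b c d e f g * ((Gamma (1 + a - e))⁻¹ * (Gamma (1 + b - e))⁻¹ *
    (Gamma (1 + c - e))⁻¹ * (Gamma (1 + d - e))⁻¹) -
  entireSeries (1 + a - e) (1 + b - e) (1 + c - e) (1 + d - e) (2 - e) (1 + f - e) (1 + g - e) *
    ((Gamma a)⁻¹ * (Gamma b)⁻¹ * (Gamma c)⁻¹ * (Gamma d)⁻¹)

theorem ofReal_saalSeries (a b c d e f g : ℝ) :
    ((saalSeries a b c d e f g : ℝ) : ℂ) = Fstar a b c d e f g := by
  rw [saalSeries, Fstar, Complex.ofReal_tsum]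
  refine tsum_congr fun k => ?_
  simp only [gaussTerm]
  push_cast
  simp only [← Complex.Gamma_ofReal]
  push_cast
  rw [div_mul_div_comm]
  ring_nf

theorem ne_neg_natCast_of_pos {x : ℝ} (hx : 0 < x) (m : ℕ) : (x : ℂ) ≠ -m := by
  intro h
  have h1 : x = -m := by exact_mod_cast h
  have : (0 : ℝ) ≤ m := by positivity
  linarith

theorem Gamma_ofReal_ne_zero_of_pos {x : ℝ} (hx : 0 < x) : Gamma (x : ℂ) ≠ 0 :=
  Gamma_ne_zero (ne_neg_natCast_of_pos hx)

theorem entirePair_ofReal {a b c d e f g : ℝ} (ha : 0 < a) (hb : 0 < b) (hc : 0 < c)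
    (hd : 0 < d) (ha' : 0 < 1 + a - e) (hb' : 0 < 1 + b - e) (hc' : 0 < 1 + c - e)
    (hd' : 0 < 1 + d - e) :
    Gamma a * Gamma b * Gamma c * Gamma d * (Gamma ((1 + a - e : ℝ) : ℂ) *
      Gamma ((1 + b - e : ℝ) : ℂ) * Gamma ((1 + c - e : ℝ) : ℂ) * Gamma ((1 + d - e : ℝ) : ℂ)) *
      entirePair a b c d e f g = (saalPair a b c d e f g : ℝ) := by
  have g1 := Gamma_ofReal_ne_zero_of_pos ha
  have g2 := Gamma_ofReal_ne_zero_of_pos hb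
  have g3 := Gamma_ofReal_ne_zero_of_pos hc
  have g4 := Gamma_ofReal_ne_zero_of_pos hd
  have g5 := Gamma_ofReal_ne_zero_of_pos ha'
  have g6 := Gamma_ofReal_ne_zero_of_pos hb'
  have g7 := Gamma_ofReal_ne_zero_of_pos hc'
  have g8 := Gamma_ofReal_ne_zero_of_pos hd'
  have n5 := ne_neg_natCast_of_pos ha'
  have n6 := ne_neg_natCast_of_pos hb'
  have n7 := ne_neg_natCast_of_pos hc'
  have n8 := ne_neg_natCast_of_pos hd'
  rw [saalPair, Complex.ofReal_sub (saalSeries a b c d e f g), ofReal_saalSeries, ofReal_saalSeries, entirePair,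
    Fstar_eq_mul_entireSeries _ _ _ (ne_neg_natCast_of_pos ha) (ne_neg_natCast_of_pos hb)
      (ne_neg_natCast_of_pos hc) (ne_neg_natCast_of_pos hd),
    Fstar_eq_mul_entireSeries _ _ _ n5 n6 n7 n8]
  push_cast at g5 g6 g7 g8 ⊢
  field_simp

theorem differentiable_entirePair {a b c d e f g : ℂ → ℂ} (ha : Differentiable ℂ a)
    (hb : Differentiable ℂ b) (hc : Differentiable ℂ c) (hd : Differentiable ℂ d)
    (he : Differentiable ℂ e) (hf : Differentiable ℂ f) (hg : Differentiable ℂ g)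
    (hs : ∀ z, e z + f z + g z = a z + b z + c z + d z + 1) :
    Differentiable ℂ fun z => entirePair (a z) (b z) (c z) (d z) (e z) (f z) (g z) := by
  have hG : ∀ {x : ℂ → ℂ}, Differentiable ℂ x → Differentiable ℂ fun z => (Gamma (x z))⁻¹ :=
    fun hx => differentiable_one_div_Gamma.comp hx
  have sh : ∀ {x : ℂ → ℂ}, Differentiable ℂ x → Differentiable ℂ fun z => 1 + x z - e z :=
    fun hx => (hx.const_add 1).sub he
  have h1 := differentiable_entireSeries ha hb hc hd he hf hg hs
  have h2 := differentiable_entireSeries (sh ha) (sh hb) (sh hc) (sh hd) (he.const_sub 2) (sh hf)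
    (sh hg) fun z => by linear_combination hs z
  exact (h1.mul ((((hG (sh ha)).mul (hG (sh hb))).mul (hG (sh hc))).mul (hG (sh hd)))).sub
    (h2.mul ((((hG ha).mul (hG hb)).mul (hG hc)).mul (hG hd)))

open Filter Topology in
theorem Differentiable.eq_zero_of_real_segment {q : ℂ → ℂ} (hq : Differentiable ℂ q) {ε : ℝ}
    (hε : 0 < ε) (h : ∀ t : ℝ, |t| < ε → q t = 0) (z : ℂ) : q z = 0 := by
  have hfr : ∃ᶠ w in 𝓝[≠] (0 : ℂ), q w = (0 : ℂ → ℂ) w := by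
    have ht : Tendsto (fun n : ℕ => ((1 / ((n : ℝ) + 1) : ℝ) : ℂ)) atTop (𝓝[≠] 0) := by
      refine tendsto_nhdsWithin_iff.2 ⟨?_, Eventually.of_forall fun n => ?_⟩
      · have := (Complex.continuous_ofReal.tendsto 0).comp
          (tendsto_one_div_add_atTop_nhds_zero_nat (𝕜 := ℝ))
        rwa [Complex.ofReal_zero] at this
      · have : (1 / ((n : ℝ) + 1) : ℝ) ≠ 0 := by positivity
        exact fun h0 => this (Complex.ofReal_eq_zero.1 h0)
    refine ht.frequently (Eventually.frequently ?_)
    filter_upwards [(tendsto_one_div_add_atTop_nhds_zero_nat (𝕜 := ℝ)).eventually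
      (gt_mem_nhds hε)] with n hn
    exact h _ (by rwa [abs_of_nonneg (by positivity)])
  have := AnalyticOnNhd.eq_of_frequently_eq (f := q) (g := 0)
    (fun x _ => hq.analyticAt x) (fun x _ => analyticAt_const) hfr
  rw [this, Pi.zero_apply]

theorem eq_zero_of_differentiable_on_lines {ι : Type*} [Fintype ι] {T : (ι → ℂ) → ℂ}
    (hT : ∀ p w : ι → ℂ, Differentiable ℂ fun z : ℂ => T (p + z • w)) (p₀ : ι → ℝ) {ε : ℝ}
    (hε : 0 < ε)
    (h : ∀ x : ι → ℝ, (∀ i, |x i - p₀ i| < ε) → T (fun i => (x i : ℂ)) = 0) (p : ι → ℂ) :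
    T p = 0 := by
  have hreal : ∀ x : ι → ℝ, T (fun i => (x i : ℂ)) = 0 := fun x => by
    set B := ∑ i, |x i - p₀ i| with hB
    have hB0 : 0 ≤ B := Finset.sum_nonneg fun i _ => abs_nonneg _
    have h1 := (hT (fun i => (p₀ i : ℂ)) (fun i => ((x i - p₀ i : ℝ) : ℂ))).eq_zero_of_real_segment
      (ε := ε / (B + 1)) (by positivity) (fun t ht => by
        have h2 := h (fun i => p₀ i + t * (x i - p₀ i)) fun i => by
          have h3 : |x i - p₀ i| ≤ B :=
            Finset.single_le_sum (f := fun i => |x i - p₀ i|) (fun i _ => abs_nonneg _)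
              (Finset.mem_univ i)
          rw [lt_div_iff₀ (by positivity)] at ht
          rw [add_sub_cancel_left, abs_mul]
          nlinarith [abs_nonneg t, abs_nonneg (x i - p₀ i)]
        rw [← h2]
        congr 1
        funext i
        simp) 1
    rw [← h1]
    congr 1
    funext i
    simp
  have h1 := (hT (fun i => ((p i).re : ℂ)) (fun i => ((p i).im : ℂ))).eq_zero_of_real_segment
    one_pos (fun t _ => by
      rw [← hreal fun i => (p i).re + t * (p i).im]
      congr 1
      funext i
      simp) I
  rw [← h1]
  congr 1
  funext i
  simp [mul_comm I, Complex.re_add_im]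

theorem sin_pi_mul_ne_zero_of_mem_Ioo {x : ℝ} (n : ℤ) (h1 : n < x) (h2 : x < n + 1) :
    Real.sin (Real.pi * x) ≠ 0 := by
  rw [Ne, Real.sin_eq_zero_iff]
  rintro ⟨m, hm⟩
  have h3 : (m : ℝ) = x := by
    have := Real.pi_ne_zero
    rw [mul_comm] at hm
    exact mul_left_cancel₀ this hm
  rw [← h3] at h1 h2
  have h4 : n < m := by exact_mod_cast h1
  have h5 : m < n + 1 := by exact_mod_cast h2
  omega

theorem Sn_ofReal (x : ℝ) : Sn x = (Real.sin (Real.pi * x) : ℝ) := by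
  rw [Sn]
  push_cast
  rfl

theorem entirePair_transform_of_real {a b c d e f g : ℝ} (ha : 0 < a) (hb : 0 < b) (hc : 0 < c)
    (hd : 0 < d) (ha' : 0 < 1 + a - e) (hb' : 0 < 1 + b - e) (hc' : 0 < 1 + c - e)
    (hd' : 0 < 1 + d - e) (haf : a < f) (hag : a < g) (hbf : b < f) (hbg : b < g)
    (hdf : d < f) (hdg : d < g) (hcf : c < f) (hcg : c < g)
    (hs : e + f + g = a + b + c + d + 1) (habe : a + b < e) (hcde : c + d < e)
    (hsin : Real.sin (Real.pi * e) ≠ 0)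
    (hsin' : Real.sin (Real.pi * (1 + c - d)) ≠ 0)
    (hsin'' : Real.sin (Real.pi * (1 + f - g)) ≠ 0) :
    Sn (1 + f - g) * entirePair a b c d e f g =
      Sn e * entirePair (f - b) (f - a) (f - d) (f - c) (1 + f - g) f (1 + f - e) := by
  have h := saalPair_transform_transform ha hb hc hd ha' hb' hc' hd' haf hag hbf hbg hdf hdg hcf
    hcg hs habe hcde hsin hsin' hsin''
  have h' := congrArg (fun x : ℝ => (x : ℂ)) h
  simp only [Complex.ofReal_mul, ← Complex.Gamma_ofReal, ← Sn_ofReal] at h'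
  rw [← entirePair_ofReal ha hb hc hd ha' hb' hc' hd',
    ← entirePair_ofReal (by linarith) (by linarith) (by linarith) (by linarith) (by linarith)
      (by linarith) (by linarith) (by linarith),
    show 1 + (f - b) - (1 + f - g) = g - b by ring,
    show 1 + (f - a) - (1 + f - g) = g - a by ring,
    show 1 + (f - d) - (1 + f - g) = g - d by ring,
    show 1 + (f - c) - (1 + f - g) = g - c by ring] at h'
  have hne : Gamma a * Gamma b * Gamma c * Gamma d * (Gamma ((1 + a - e : ℝ) : ℂ) *
      Gamma ((1 + b - e : ℝ) : ℂ) * Gamma ((1 + c - e : ℝ) : ℂ) * Gamma ((1 + d - e : ℝ) : ℂ)) *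
      (Gamma ((f - a : ℝ) : ℂ) * Gamma ((f - b : ℝ) : ℂ) *
      Gamma ((f - c : ℝ) : ℂ) * Gamma ((f - d : ℝ) : ℂ) * (Gamma ((g - a : ℝ) : ℂ) *
      Gamma ((g - b : ℝ) : ℂ) * Gamma ((g - c : ℝ) : ℂ) * Gamma ((g - d : ℝ) : ℂ))) ≠ 0 := by
    have := fun {x : ℝ} (hx : 0 < x) => Gamma_ofReal_ne_zero_of_pos hx
    refine mul_ne_zero (mul_ne_zero ?_ ?_) (mul_ne_zero ?_ ?_) <;>
      refine mul_ne_zero (mul_ne_zero (mul_ne_zero (this ?_) (this ?_)) (this ?_)) (this ?_) <;>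
      linarith
  refine mul_left_cancel₀ hne ?_
  push_cast at h' ⊢
  linear_combination h'

theorem entirePair_transform {a b c d e f g : ℂ} (hs : e + f + g = a + b + c + d + 1) :
    Sn (1 + f - g) * entirePair a b c d e f g =
      Sn e * entirePair (f - b) (f - a) (f - d) (f - c) (1 + f - g) f (1 + f - e) := by
  let G : (Fin 6 → ℂ) → ℂ := fun p => p 0 + p 1 + p 2 + p 3 + 1 - p 4 - p 5
  let T : (Fin 6 → ℂ) → ℂ := fun p =>
    Sn (1 + p 5 - G p) * entirePair (p 0) (p 1) (p 2) (p 3) (p 4) (p 5) (G p) -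
    Sn (p 4) * entirePair (p 5 - p 1) (p 5 - p 0) (p 5 - p 3) (p 5 - p 2) (1 + p 5 - G p) (p 5)
      (1 + p 5 - p 4)
  have hT : T ![a, b, c, d, e, f] = 0 := by
    refine eq_zero_of_differentiable_on_lines (T := T) (fun p w => ?_)
      ![1 / 4, 1 / 4, 1 / 4, 3 / 10, 11 / 10, 1 / 2] (ε := 1 / 200) (by norm_num) (fun x hx => ?_) _
    · have hp : ∀ i, Differentiable ℂ fun z : ℂ => (p + z • w) i := fun i => by
        simp only [Pi.add_apply, Pi.smul_apply, smul_eq_mul]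
        fun_prop
      have hG : Differentiable ℂ fun z : ℂ => G (p + z • w) :=
        ((((((hp 0).add (hp 1)).add (hp 2)).add (hp 3)).add_const 1).sub (hp 4)).sub (hp 5)
      have hS : ∀ {y : ℂ → ℂ}, Differentiable ℂ y → Differentiable ℂ fun z => Sn (y z) := fun hy => by
        unfold Sn
        fun_prop
      have hfg : Differentiable ℂ fun z : ℂ => 1 + (p + z • w) 5 - G (p + z • w) :=
        ((hp 5).const_add 1).sub hG
      refine ((hS hfg).mul (differentiable_entirePair (hp 0) (hp 1) (hp 2) (hp 3) (hp 4) (hp 5) hG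
        fun z => ?_)).sub ((hS (hp 4)).mul (differentiable_entirePair ((hp 5).sub (hp 1))
        ((hp 5).sub (hp 0)) ((hp 5).sub (hp 3)) ((hp 5).sub (hp 2)) hfg (hp 5)
        (((hp 5).const_add 1).sub (hp 4)) fun z => ?_)) <;> simp only [G] <;> ring
    · have h0 := abs_lt.1 (hx 0)
      have h1 := abs_lt.1 (hx 1)
      have h2 := abs_lt.1 (hx 2)
      have h3 := abs_lt.1 (hx 3)
      have h4 := abs_lt.1 (hx 4)
      have h5 := abs_lt.1 (hx 5)
      simp only [Fin.isValue, Matrix.cons_val] at h0 h1 h2 h3 h4 h5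
      obtain ⟨a0, b0⟩ := h0
      obtain ⟨a1, b1⟩ := h1
      obtain ⟨a2, b2⟩ := h2
      obtain ⟨a3, b3⟩ := h3
      obtain ⟨a4, b4⟩ := h4
      obtain ⟨a5, b5⟩ := h5
      have key := entirePair_transform_of_real (a := x 0) (b := x 1) (c := x 2) (d := x 3)
        (e := x 4) (f := x 5) (g := x 0 + x 1 + x 2 + x 3 + 1 - x 4 - x 5)
        (by linarith) (by linarith) (by linarith) (by linarith) (by linarith) (by linarith)
        (by linarith) (by linarith) (by linarith) (by linarith) (by linarith) (by linarith)
        (by linarith) (by linarith) (by linarith) (by linarith) (by linarith) (by linarith)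
        (by linarith)
        (sin_pi_mul_ne_zero_of_mem_Ioo 1 (by push_cast; linarith) (by push_cast; linarith))
        (sin_pi_mul_ne_zero_of_mem_Ioo 0 (by push_cast; linarith) (by push_cast; linarith))
        (sin_pi_mul_ne_zero_of_mem_Ioo 1 (by push_cast; linarith) (by push_cast; linarith))
      push_cast at key
      exact sub_eq_zero.2 key
  have hg : g = a + b + c + d + 1 - e - f := by linear_combination hs
  rw [hg]
  exact sub_eq_zero.1 hT

open Filter Topology in
theorem exists_eq_sum_of_tendsto_div_pow (n : ℕ) : ∀ {H : ℂ → ℂ}, Differentiable ℂ H →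
    Tendsto (fun q => H q / q ^ n) (cocompact ℂ) (𝓝 0) →
    ∃ c : ℕ → ℂ, ∀ q, H q = ∑ i ∈ Finset.range n, c i * q ^ i := by
  induction n with
  | zero =>
    intro H hH h
    exact ⟨0, fun q => by simpa using hH.apply_eq_of_tendsto_cocompact q (by simpa using h)⟩
  | succ n ih =>
    intro H hH h
    have hd : Differentiable ℂ (dslope H 0) := by
      rw [← differentiableOn_univ, Complex.differentiableOn_dslope univ_mem]
      exact hH.differentiableOn
    have hinv : Tendsto (fun q : ℂ => H 0 * (q⁻¹) ^ (n + 1)) (cocompact ℂ) (𝓝 0) := by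
      have := ((tendsto_inv₀_cobounded (α := ℂ)).pow (n + 1)).const_mul (H 0)
      rw [Metric.cobounded_eq_cocompact] at this
      simpa using this
    obtain ⟨c, hc⟩ := ih hd (by
      have h1 := h.sub hinv
      rw [sub_zero] at h1
      refine h1.congr' ?_
      have h0 : ∀ᶠ q : ℂ in cocompact ℂ, q ≠ 0 :=
        isCompact_singleton.compl_mem_cocompact
      filter_upwards [h0] with q hq
      rw [dslope_of_ne _ hq, slope_def_field, sub_zero, inv_pow]
      field_simp
      ring)
    refine ⟨fun i => if i = 0 then H 0 else c (i - 1), fun q => ?_⟩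
    rw [Finset.sum_range_succ']
    have h1 := sub_smul_dslope H 0 q
    rw [hc, smul_eq_mul, sub_zero] at h1
    simp only [Nat.succ_ne_zero, if_false, if_true, Nat.add_sub_cancel, pow_zero, mul_one]
    rw [show ∑ i ∈ Finset.range n, c i * q ^ (i + 1) = q * ∑ i ∈ Finset.range n, c i * q ^ i by
      rw [Finset.mul_sum]
      exact Finset.sum_congr rfl fun i _ => by ring]
    linear_combination -h1

open Filter Topology Function.Periodic in
/-- An entire function of period one that grows more slowly than `exp (4 π |im s|)` is a
trigonometric polynomial of degree at most one. -/
theorem exists_eq_of_periodic_of_norm_le {P : ℂ → ℂ} (hP : Differentiable ℂ P)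
    (hper : Function.Periodic P 1) {T : ℝ → ℝ} (hT : Tendsto T atTop (𝓝 0)) {r : ℝ}
    (hbd : ∀ s : ℂ, r ≤ |s.im| → ‖P s‖ ≤ T |s.im| * Real.exp (4 * Real.pi * |s.im|)) :
    ∃ α β γ : ℂ, ∀ s, P s = α * exp (-(2 * Real.pi * I * s)) + β + γ * exp (2 * Real.pi * I * s) := by
  have hpi := Real.pi_pos
  have hqexp : ∀ s, qParam 1 s = exp (2 * Real.pi * I * s) := fun s => by simp [qParam]
  set F : ℂ → ℂ := fun s => qParam 1 s ^ 2 * P s with hF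
  have hFd : Differentiable ℂ F := by
    simp only [hF, hqexp]
    fun_prop
  have hFper : Function.Periodic F (1 : ℝ) := fun s => by
    have h1 : qParam 1 (s + 1) = qParam 1 s := by
      rw [hqexp, hqexp, mul_add, mul_one, Complex.exp_add, Complex.exp_two_pi_mul_I, mul_one]
    simp only [hF, ofReal_one, h1, hper s]
  have hFnorm : ∀ s, ‖F s‖ = Real.exp (-(4 * Real.pi * s.im)) * ‖P s‖ := fun s => by
    rw [hF, norm_mul, norm_pow, norm_qParam, ← Real.exp_nat_mul]
    push_cast
    congr 2
    ring
  have hzero : Tendsto F (comap Complex.im atTop) (𝓝 0) := by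
    refine squeeze_zero_norm' ?_ (hT.comp tendsto_comap)
    filter_upwards [preimage_mem_comap (eventually_ge_atTop r),
      preimage_mem_comap (eventually_ge_atTop 0)] with s hs hs0
    simp only [Set.mem_preimage, Set.mem_ofPred_eq] at hs hs0
    have h1 := hbd s
    rw [abs_of_nonneg hs0] at h1
    rw [hFnorm, Function.comp]
    calc _ ≤ Real.exp (-(4 * Real.pi * s.im)) * (T s.im * Real.exp (4 * Real.pi * s.im)) :=
          mul_le_mul_of_nonneg_left (h1 hs) (Real.exp_pos _).le
      _ = T s.im := by rw [mul_left_comm, ← Real.exp_add]; simp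
  set H := cuspFunction 1 F with hH
  have hHd : Differentiable ℂ H := fun q => by
    by_cases hq : q = 0
    · rw [hq]
      refine differentiableAt_cuspFunction_zero one_pos hFper
        (Eventually.of_forall fun z => hFd z) ?_
      exact hzero.isBigO_one ℝ
    · rw [← qParam_right_inv one_ne_zero hq]
      exact differentiableAt_cuspFunction one_ne_zero hFper (hFd _)
  have hHq : ∀ s, H (qParam 1 s) = F s := fun s => eq_cuspFunction one_ne_zero hFper s
  have hH0 : H 0 = 0 := cuspFunction_zero_of_zero_at_inf one_pos hzero
  have hlim : Tendsto (fun q => H q / q ^ 4) (cocompact ℂ) (𝓝 0) := by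
    have hl : Tendsto (fun q : ℂ => (2 * Real.pi)⁻¹ * Real.log ‖q‖) (cocompact ℂ) atTop :=
      (Real.tendsto_log_atTop.comp (tendsto_norm_cocompact_atTop)).const_mul_atTop (by positivity)
    refine squeeze_zero_norm' ?_ (hT.comp hl)
    have h0 : ∀ᶠ q : ℂ in cocompact ℂ, q ≠ 0 := isCompact_singleton.compl_mem_cocompact
    filter_upwards [h0, hl.eventually_ge_atTop r, hl.eventually_ge_atTop 0] with q hq h1 h2
    set s := invQParam 1 q with hs
    have hqs : qParam 1 s = q := qParam_right_inv one_ne_zero hq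
    have him : |s.im| = (2 * Real.pi)⁻¹ * Real.log ‖q‖ := by
      have h4 : s.im = -((2 * Real.pi)⁻¹ * Real.log ‖q‖) := by
        rw [hs, im_invQParam]
        field_simp
      rw [h4, abs_neg, abs_of_nonneg h2]
    have him' : s.im = - |s.im| := by
      rw [him, hs, im_invQParam]
      field_simp
    have h5 := hbd s (by rw [him]; exact h1)
    rw [← hqs, hHq, norm_div, hFnorm, norm_pow, norm_qParam, ← Real.exp_nat_mul, Function.comp,
      hqs, ← him, div_le_iff₀ (Real.exp_pos _)]
    calc _ ≤ Real.exp (-(4 * Real.pi * s.im)) * (T |s.im| * Real.exp (4 * Real.pi * |s.im|)) :=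
          mul_le_mul_of_nonneg_left h5 (Real.exp_pos _).le
      _ = T |s.im| * Real.exp (-(4 * Real.pi * s.im) + 4 * Real.pi * |s.im|) := by
        rw [Real.exp_add]; ring
      _ = _ := by
        congr 2
        rw [him', abs_neg, abs_abs]
        push_cast
        ring
  obtain ⟨c, hc⟩ := exists_eq_sum_of_tendsto_div_pow 4 hHd hlim
  refine ⟨c 1, c 2, c 3, fun s => ?_⟩
  have h0 := hc 0
  have h1 := hc (qParam 1 s)
  rw [hH0] at h0
  rw [hHq] at h1
  simp only [Finset.sum_range_succ, Finset.sum_range_zero, hF, hqexp] at h0 h1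
  simp at h0
  rw [Complex.exp_neg]
  have h2 := Complex.exp_ne_zero (2 * Real.pi * I * s)
  rw [← h0] at h1
  field_simp
  refine mul_left_cancel₀ h2 ?_
  linear_combination h1

theorem Sn_add_int (x : ℂ) (k : ℤ) : Sn (x + k) = (-1) ^ k * Sn x := by
  rw [Sn, Sn, mul_add, mul_comm (Real.pi : ℂ) k, Complex.sin_antiperiodic.add_int_mul_eq,
    Int.cast_negOnePow]

theorem norm_Sn_le (x : ℂ) : ‖Sn x‖ ≤ Real.exp (Real.pi * |x.im|) := by
  have him : ((Real.pi : ℂ) * x).im = Real.pi * x.im := by simp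
  have h1 : ‖exp (-((Real.pi : ℂ) * x) * I)‖ ≤ Real.exp (Real.pi * |x.im|) := by
    rw [Complex.norm_exp]
    refine Real.exp_le_exp.2 ?_
    simp
    exact mul_le_mul_of_nonneg_left (le_abs_self _) Real.pi_pos.le
  have h2 : ‖exp ((Real.pi : ℂ) * x * I)‖ ≤ Real.exp (Real.pi * |x.im|) := by
    rw [Complex.norm_exp]
    refine Real.exp_le_exp.2 ?_
    simp
    rw [← mul_neg]
    exact mul_le_mul_of_nonneg_left (neg_le_abs _) Real.pi_pos.le
  rw [Sn, Complex.sin, norm_div, norm_mul, norm_I, mul_one, Complex.norm_ofNat]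
  have h3 := norm_sub_le (exp (-((Real.pi : ℂ) * x) * I)) (exp ((Real.pi : ℂ) * x * I))
  linarith

theorem inv_Gamma_one_sub {x : ℂ} (hx : ∀ m : ℕ, x ≠ -m) :
    (Gamma (1 - x))⁻¹ = Sn x * Gamma x / Real.pi := by
  have h1 := Complex.Gamma_mul_Gamma_one_sub x
  have h2 := Complex.Gamma_ne_zero hx
  have h3 : (Gamma (1 - x))⁻¹ = Gamma x * (Gamma x * Gamma (1 - x))⁻¹ := by
    rw [mul_inv]
    field_simp
  rw [h3, h1, Sn, inv_div]
  ring

/-- A product of eight reciprocal Gamma functions whose sum over a coset of the integers is a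
well-poised combination of one-sided Saalschützian series. -/
def recipGammaProd (a₁ a₂ a₃ a₄ b₁ b₂ b₃ b₄ z : ℂ) : ℂ :=
  (Gamma (1 - (z + a₁)))⁻¹ * (Gamma (1 - (z + a₂)))⁻¹ * (Gamma (1 - (z + a₃)))⁻¹ *
    (Gamma (1 - (z + a₄)))⁻¹ *
    ((Gamma (z + b₁))⁻¹ * (Gamma (z + b₂))⁻¹ * (Gamma (z + b₃))⁻¹ * (Gamma (z + b₄))⁻¹)

theorem recipGammaProd_neg (a₁ a₂ a₃ a₄ b₁ b₂ b₃ b₄ z : ℂ) :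
    recipGammaProd a₁ a₂ a₃ a₄ b₁ b₂ b₃ b₄ (-z) =
      recipGammaProd (1 - b₁) (1 - b₂) (1 - b₃) (1 - b₄) (1 - a₁) (1 - a₂) (1 - a₃) (1 - a₄) z := by
  simp only [recipGammaProd]
  ring_nf

theorem differentiable_recipGammaProd (a₁ a₂ a₃ a₄ b₁ b₂ b₃ b₄ : ℂ) :
    Differentiable ℂ (recipGammaProd a₁ a₂ a₃ a₄ b₁ b₂ b₃ b₄) := by
  have hG : ∀ {x : ℂ → ℂ}, Differentiable ℂ x → Differentiable ℂ fun z => (Gamma (x z))⁻¹ :=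
    fun hx => differentiable_one_div_Gamma.comp hx
  have h1 : ∀ a : ℂ, Differentiable ℂ fun z => (Gamma (1 - (z + a)))⁻¹ :=
    fun a => hG (by fun_prop)
  have h2 : ∀ b : ℂ, Differentiable ℂ fun z => (Gamma (z + b))⁻¹ := fun b => hG (by fun_prop)
  exact (((h1 a₁).mul (h1 a₂)).mul (h1 a₃)).mul (h1 a₄) |>.mul
    ((((h2 b₁).mul (h2 b₂)).mul (h2 b₃)).mul (h2 b₄))

theorem recipGammaProd_eq {a₁ a₂ a₃ a₄ z : ℂ} (b₁ b₂ b₃ b₄ : ℂ) (h₁ : ∀ m : ℕ, z + a₁ ≠ -m)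
    (h₂ : ∀ m : ℕ, z + a₂ ≠ -m) (h₃ : ∀ m : ℕ, z + a₃ ≠ -m) (h₄ : ∀ m : ℕ, z + a₄ ≠ -m) :
    recipGammaProd a₁ a₂ a₃ a₄ b₁ b₂ b₃ b₄ z =
      Sn (z + a₁) * Sn (z + a₂) * Sn (z + a₃) * Sn (z + a₄) / Real.pi ^ 4 *
      (Gamma (z + a₁) * Gamma (z + a₂) * Gamma (z + a₃) * Gamma (z + a₄) /
        (Gamma (z + b₁) * Gamma (z + b₂) * Gamma (z + b₃) * Gamma (z + b₄))) := by
  rw [recipGammaProd, inv_Gamma_one_sub h₁, inv_Gamma_one_sub h₂, inv_Gamma_one_sub h₃,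
    inv_Gamma_one_sub h₄, div_eq_mul_inv (Gamma (z + a₁) * _ * _ * _)]
  simp only [mul_inv]
  ring

theorem exists_norm_recipGammaProd_le {a₁ a₂ a₃ a₄ b₁ b₂ b₃ b₄ : ℂ}
    (hs : b₁ + b₂ + b₃ + b₄ = a₁ + a₂ + a₃ + a₄ + 2) :
    ∃ r M : ℝ, 0 < r ∧ 0 ≤ M ∧ ∀ z : ℂ, (∀ k : ℕ, r ≤ ‖z + k‖) →
      ‖recipGammaProd a₁ a₂ a₃ a₄ b₁ b₂ b₃ b₄ z‖ ≤
        M * Real.exp (4 * Real.pi * |z.im|) / ‖z‖ ^ 2 := by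
  set R : ℝ := 1 + ‖a₁‖ + ‖a₂‖ + ‖a₃‖ + ‖a₄‖ + ‖b₁‖ + ‖b₂‖ + ‖b₃‖ + ‖b₄‖ with hR
  have ha₁ := norm_nonneg a₁
  have ha₂ := norm_nonneg a₂
  have ha₃ := norm_nonneg a₃
  have ha₄ := norm_nonneg a₄
  have hb₁ := norm_nonneg b₁
  have hb₂ := norm_nonneg b₂
  have hb₃ := norm_nonneg b₃
  have hb₄ := norm_nonneg b₄
  have hpi := Real.pi_pos
  obtain ⟨M, hM, h⟩ := exists_norm_Gamma_quotient_le (R := R) (by linarith)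
  refine ⟨2 * R, Real.exp (4 * Real.pi * R) / Real.pi ^ 4 * M, by linarith, by positivity,
    fun z hz => ?_⟩
  have hne : ∀ x : ℂ, ‖x‖ ≤ R → ∀ m : ℕ, z + x ≠ -m := fun x hx m hm => by
    have h1 := hz m
    rw [show z + m = -x by linear_combination hm, norm_neg] at h1
    linarith
  have hS : ∀ x : ℂ, ‖x‖ ≤ R → ‖Sn (z + x)‖ ≤ Real.exp (Real.pi * (|z.im| + R)) := fun x hx => by
    refine (norm_Sn_le _).trans (Real.exp_le_exp.2 (mul_le_mul_of_nonneg_left ?_ hpi.le))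
    rw [add_im]
    refine (abs_add_le _ _).trans ?_
    linarith [Complex.abs_im_le_norm x]
  have h1 : ‖a₁‖ ≤ R := by linarith
  have h2 : ‖a₂‖ ≤ R := by linarith
  have h3 : ‖a₃‖ ≤ R := by linarith
  have h4 : ‖a₄‖ ≤ R := by linarith
  have key := h a₁ a₂ a₃ a₄ b₁ b₂ b₃ b₄ z h1 h2 h3 h4 (by linarith) (by linarith) (by linarith)
    (by linarith) hs hz
  rw [recipGammaProd_eq _ _ _ _ (hne a₁ h1) (hne a₂ h2) (hne a₃ h3) (hne a₄ h4), norm_mul, norm_div,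
    norm_pow, norm_mul, norm_mul, norm_mul, norm_real, Real.norm_of_nonneg hpi.le]
  have hprod : ‖Sn (z + a₁)‖ * ‖Sn (z + a₂)‖ * ‖Sn (z + a₃)‖ * ‖Sn (z + a₄)‖ ≤
      Real.exp (4 * Real.pi * R) * Real.exp (4 * Real.pi * |z.im|) := by
    calc _ ≤ Real.exp (Real.pi * (|z.im| + R)) * Real.exp (Real.pi * (|z.im| + R)) *
          Real.exp (Real.pi * (|z.im| + R)) * Real.exp (Real.pi * (|z.im| + R)) := by
          gcongr <;> apply hS <;> assumption
      _ = _ := by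
        simp only [← Real.exp_add]
        congr 1
        ring
  calc _ ≤ Real.exp (4 * Real.pi * R) * Real.exp (4 * Real.pi * |z.im|) / Real.pi ^ 4 *
        (M / ‖z‖ ^ 2) := by gcongr
    _ = _ := by ring

theorem exists_norm_recipGammaProd_add_int_le {a₁ a₂ a₃ a₄ b₁ b₂ b₃ b₄ : ℂ}
    (hs : b₁ + b₂ + b₃ + b₄ = a₁ + a₂ + a₃ + a₄ + 2) (ρ : ℝ) :
    ∃ (N : ℕ) (M : ℝ), ∀ s : ℂ, ‖s‖ ≤ ρ → ∀ k : ℤ, (N : ℤ) ≤ |k| →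
      ‖recipGammaProd a₁ a₂ a₃ a₄ b₁ b₂ b₃ b₄ (s + k)‖ ≤ M * (1 / (k : ℝ) ^ 2) := by
  have aux : ∀ {a₁ a₂ a₃ a₄ b₁ b₂ b₃ b₄ : ℂ}, b₁ + b₂ + b₃ + b₄ = a₁ + a₂ + a₃ + a₄ + 2 →
      ∃ (N : ℕ) (M : ℝ), 0 ≤ M ∧ ∀ s : ℂ, ‖s‖ ≤ ρ → ∀ k : ℤ, (N : ℤ) ≤ k →
      ‖recipGammaProd a₁ a₂ a₃ a₄ b₁ b₂ b₃ b₄ (s + k)‖ ≤ M * (1 / (k : ℝ) ^ 2) := by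
    intro a₁ a₂ a₃ a₄ b₁ b₂ b₃ b₄ hs
    obtain ⟨r, M, hr, hM, h⟩ := exists_norm_recipGammaProd_le hs
    obtain ⟨N, hN⟩ := exists_nat_ge (r + 2 * |ρ|)
    have hpi := Real.pi_pos
    refine ⟨N, M * Real.exp (4 * Real.pi * |ρ|) * 4, by positivity, fun s hsρ k hk => ?_⟩
    have hsρ' : ‖s‖ ≤ |ρ| := hsρ.trans (le_abs_self _)
    have hk' : (N : ℝ) ≤ k := by exact_mod_cast hk
    have hk0 : (0 : ℝ) < k := by linarith [abs_nonneg ρ]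
    have hlow : ∀ j : ℕ, (k : ℝ) + j - |ρ| ≤ ‖s + k + j‖ := fun j => by
      have h1 : (k : ℝ) + j ≤ ‖((k : ℂ) + j)‖ := by
        have := Complex.re_le_norm ((k : ℂ) + j)
        simpa using this
      have h2 := norm_sub_le (s + k + j) s
      rw [show s + (k : ℂ) + j - s = k + j by ring] at h2
      linarith
    have h3 := h (s + k) fun j => by
      have := hlow j
      have : (0 : ℝ) ≤ j := Nat.cast_nonneg j
      linarith [abs_nonneg ρ]
    have h4 : (k : ℝ) / 2 ≤ ‖s + k‖ := by
      have := hlow 0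
      simp at this
      linarith
    have h5 : |(s + (k : ℂ)).im| ≤ |ρ| := by
      simp
      exact (Complex.abs_im_le_norm s).trans hsρ'
    calc _ ≤ _ := h3
      _ ≤ M * Real.exp (4 * Real.pi * |ρ|) / ((k : ℝ) / 2) ^ 2 := by gcongr
      _ = _ := by field_simp; norm_num
  obtain ⟨N₁, M₁, hM₁, h₁⟩ := aux hs
  obtain ⟨N₂, M₂, hM₂, h₂⟩ := aux (a₁ := 1 - b₁) (a₂ := 1 - b₂) (a₃ := 1 - b₃) (a₄ := 1 - b₄)
    (b₁ := 1 - a₁) (b₂ := 1 - a₂) (b₃ := 1 - a₃) (b₄ := 1 - a₄) (by linear_combination hs)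
  refine ⟨max N₁ N₂, max M₁ M₂, fun s hsρ k hk => ?_⟩
  rw [Nat.cast_max, max_le_iff] at hk
  rcases le_total 0 k with hk0 | hk0
  · rw [abs_of_nonneg hk0] at hk
    refine (h₁ s hsρ k hk.1).trans ?_
    gcongr
    exact le_max_left _ _
  · rw [abs_of_nonpos hk0] at hk
    have h3 := h₂ (-s) (by rwa [norm_neg]) (-k) hk.2
    rw [← recipGammaProd_neg] at h3
    push_cast at h3
    rw [show -(-s + -(k : ℂ)) = s + k by ring, neg_sq] at h3
    refine h3.trans ?_
    gcongr
    exact le_max_right _ _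

/-- The bilateral sum of `recipGammaProd` over a coset of the integers. -/
def recipGammaSum (a₁ a₂ a₃ a₄ b₁ b₂ b₃ b₄ s : ℂ) : ℂ :=
  ∑' k : ℤ, recipGammaProd a₁ a₂ a₃ a₄ b₁ b₂ b₃ b₄ (s + k)

theorem recipGammaSum_add_int (a₁ a₂ a₃ a₄ b₁ b₂ b₃ b₄ s : ℂ) (n : ℤ) :
    recipGammaSum a₁ a₂ a₃ a₄ b₁ b₂ b₃ b₄ (s + n) =
      recipGammaSum a₁ a₂ a₃ a₄ b₁ b₂ b₃ b₄ s := by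
  rw [recipGammaSum, recipGammaSum, ← (Equiv.addLeft n).tsum_eq
    (fun k : ℤ => recipGammaProd a₁ a₂ a₃ a₄ b₁ b₂ b₃ b₄ (s + k))]
  refine tsum_congr fun k => ?_
  simp only [Equiv.coe_addLeft]
  push_cast
  ring_nf

theorem differentiable_recipGammaSum {a₁ a₂ a₃ a₄ b₁ b₂ b₃ b₄ : ℂ}
    (hs : b₁ + b₂ + b₃ + b₄ = a₁ + a₂ + a₃ + a₄ + 2) :
    Differentiable ℂ (recipGammaSum a₁ a₂ a₃ a₄ b₁ b₂ b₃ b₄) := by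
  intro s₀
  set U := recipGammaProd a₁ a₂ a₃ a₄ b₁ b₂ b₃ b₄ with hU
  obtain ⟨N, M, h⟩ := exists_norm_recipGammaProd_add_int_le hs (‖s₀‖ + 1)
  have hUd : ∀ k : ℤ, Differentiable ℂ fun s => U (s + k) := fun k =>
    (differentiable_recipGammaProd a₁ a₂ a₃ a₄ b₁ b₂ b₃ b₄).comp (differentiable_id.add_const _)
  have hC : ∀ k : ℤ, ∃ C, ∀ s ∈ Metric.closedBall (0 : ℂ) (‖s₀‖ + 1), ‖U (s + k)‖ ≤ C := fun k =>
    (isCompact_closedBall _ _).exists_bound_of_continuousOn (hUd k).continuous.continuousOn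
  choose C hC using hC
  have hsum : Summable fun k : ℤ => if (N : ℤ) ≤ |k| then M * (1 / (k : ℝ) ^ 2) else C k := by
    refine (summable_congr_cofinite ?_).2
      (((Real.summable_one_div_int_pow (p := 2)).2 one_lt_two).mul_left M)
    filter_upwards [((Set.finite_Ioo (-(N : ℤ)) N)).compl_mem_cofinite] with k hk
    refine if_pos ?_
    by_contra hlt
    exact hk (abs_lt.1 (not_le.1 hlt))
  have hd : DifferentiableOn ℂ (fun s => ∑' k : ℤ, U (s + k)) (Metric.ball 0 (‖s₀‖ + 1)) := by
    refine differentiableOn_tsum_of_summable_norm hsum (fun k => (hUd k).differentiableOn)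
      Metric.isOpen_ball fun k s hsb => ?_
    have hsb' := Metric.ball_subset_closedBall hsb
    split_ifs with hk
    · exact h s (by simpa using hsb') k hk
    · exact hC k s hsb'
  exact hd.differentiableAt (Metric.isOpen_ball.mem_nhds (by simp))

theorem summable_two_div_sq_add_int_sq {y : ℝ} (hy : 1 ≤ y) :
    Summable fun k : ℤ => 2 / (y ^ 2 + (k : ℝ) ^ 2) := by
  refine (summable_one_div_one_add_int_sq.mul_left 2).of_nonneg_of_le (fun k => by positivity)
    fun k => ?_
  rw [mul_one_div]
  gcongr
  nlinarith

open Filter Topology in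
theorem tendsto_tsum_two_div_sq_add_int_sq :
    Tendsto (fun y : ℝ => ∑' k : ℤ, 2 / (y ^ 2 + (k : ℝ) ^ 2)) atTop (𝓝 0) := by
  have h := tendsto_tsum_of_dominated_convergence (𝓕 := atTop)
    (f := fun (y : ℝ) (k : ℤ) => 2 / (y ^ 2 + (k : ℝ) ^ 2)) (g := fun _ => 0)
    (summable_one_div_one_add_int_sq.mul_left 2) (fun k => ?_) ?_
  · simpa using h
  · exact tendsto_const_nhds.div_atTop
      (tendsto_atTop_add_const_right _ _ (tendsto_pow_atTop two_ne_zero))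
  · filter_upwards [eventually_ge_atTop 1] with y hy k
    rw [Real.norm_of_nonneg (by positivity), mul_one_div]
    gcongr
    nlinarith

open Filter Topology in
theorem exists_norm_recipGammaSum_le {a₁ a₂ a₃ a₄ b₁ b₂ b₃ b₄ : ℂ}
    (hs : b₁ + b₂ + b₃ + b₄ = a₁ + a₂ + a₃ + a₄ + 2) :
    ∃ (T : ℝ → ℝ) (r : ℝ), Tendsto T atTop (𝓝 0) ∧ ∀ s : ℂ, r ≤ |s.im| →
      ‖recipGammaSum a₁ a₂ a₃ a₄ b₁ b₂ b₃ b₄ s‖ ≤ T |s.im| * Real.exp (4 * Real.pi * |s.im|) := by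
  obtain ⟨r, M, hr, hM, h⟩ := exists_norm_recipGammaProd_le hs
  refine ⟨fun y => M * ∑' k : ℤ, 2 / (y ^ 2 + (k : ℝ) ^ 2), max r 2,
    by simpa using tendsto_tsum_two_div_sq_add_int_sq.const_mul M, fun s hs' => ?_⟩
  obtain ⟨hs1, hs2⟩ := max_le_iff.1 hs'
  have hfl : s - (⌊s.re⌋ : ℂ) = s + ((-⌊s.re⌋ : ℤ) : ℂ) := by push_cast; ring
  rw [← recipGammaSum_add_int _ _ _ _ _ _ _ _ s (-⌊s.re⌋), ← hfl]
  set t : ℂ := s - (⌊s.re⌋ : ℂ) with ht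
  have htim : t.im = s.im := by simp [ht]
  have htre : t.re = s.re - ⌊s.re⌋ := by simp [ht]
  have h0 : 0 ≤ t.re := by rw [htre]; linarith [Int.floor_le s.re]
  have h1 : t.re ≤ 1 := by rw [htre]; linarith [Int.lt_floor_add_one s.re]
  rw [← htim] at hs1 hs2 ⊢
  have hterm : ∀ k : ℤ, ‖recipGammaProd a₁ a₂ a₃ a₄ b₁ b₂ b₃ b₄ (t + k)‖ ≤
      M * Real.exp (4 * Real.pi * |t.im|) * (2 / (|t.im| ^ 2 + (k : ℝ) ^ 2)) := fun k => by
    have him : (t + (k : ℂ)).im = t.im := by simp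
    have h2 := h (t + k) fun j => by
      have := Complex.abs_im_le_norm (t + k + j)
      simp at this
      exact hs1.trans this
    rw [him] at h2
    refine h2.trans ?_
    have h3 : ‖t + (k : ℂ)‖ ^ 2 = (t.re + k) ^ 2 + |t.im| ^ 2 := by
      rw [← Complex.normSq_eq_norm_sq, Complex.normSq_apply, sq_abs]
      simp
      ring
    have h4 : (|t.im| ^ 2 + (k : ℝ) ^ 2) / 2 ≤ ‖t + (k : ℂ)‖ ^ 2 := by
      rw [h3]
      nlinarith [sq_nonneg (2 * t.re + k)]
    have h5 : 0 < (|t.im| ^ 2 + (k : ℝ) ^ 2) / 2 := by positivity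
    calc _ ≤ M * Real.exp (4 * Real.pi * |t.im|) / ((|t.im| ^ 2 + (k : ℝ) ^ 2) / 2) := by gcongr
      _ = _ := by field_simp
  have hsum := (summable_two_div_sq_add_int_sq (y := |t.im|) (by linarith)).mul_left
    (M * Real.exp (4 * Real.pi * |t.im|))
  refine (tsum_of_norm_bounded hsum.hasSum hterm).trans (le_of_eq ?_)
  rw [tsum_mul_left]
  ring

theorem exists_recipGammaSum_eq {a₁ a₂ a₃ a₄ b₁ b₂ b₃ b₄ : ℂ}
    (hs : b₁ + b₂ + b₃ + b₄ = a₁ + a₂ + a₃ + a₄ + 2) :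
    ∃ α β γ : ℂ, ∀ s, recipGammaSum a₁ a₂ a₃ a₄ b₁ b₂ b₃ b₄ s =
      α * exp (-(2 * Real.pi * I * s)) + β + γ * exp (2 * Real.pi * I * s) := by
  obtain ⟨T, r, hT, hbd⟩ := exists_norm_recipGammaSum_le hs
  refine exists_eq_of_periodic_of_norm_le (differentiable_recipGammaSum hs) (fun s => ?_) hT hbd
  simpa using recipGammaSum_add_int a₁ a₂ a₃ a₄ b₁ b₂ b₃ b₄ s 1

theorem recipGammaSum_neg (a₁ a₂ a₃ a₄ b₁ b₂ b₃ b₄ s : ℂ) :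
    recipGammaSum a₁ a₂ a₃ a₄ b₁ b₂ b₃ b₄ (-s) =
      recipGammaSum (1 - b₁) (1 - b₂) (1 - b₃) (1 - b₄) (1 - a₁) (1 - a₂) (1 - a₃) (1 - a₄) s := by
  rw [recipGammaSum, recipGammaSum, ← (Equiv.neg ℤ).tsum_eq]
  refine tsum_congr fun k => ?_
  rw [← recipGammaProd_neg, Equiv.neg_apply]
  push_cast
  rw [neg_add]

theorem recipGammaSum_one_sub {a₁ a₂ a₃ a₄ b₁ : ℂ} (b₂ b₃ b₄ : ℂ)
    (h₁ : ∀ m : ℕ, 1 + a₁ - b₁ ≠ -m) (h₂ : ∀ m : ℕ, 1 + a₂ - b₁ ≠ -m)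
    (h₃ : ∀ m : ℕ, 1 + a₃ - b₁ ≠ -m) (h₄ : ∀ m : ℕ, 1 + a₄ - b₁ ≠ -m) :
    recipGammaSum a₁ a₂ a₃ a₄ b₁ b₂ b₃ b₄ (1 - b₁) =
      Sn (a₁ - b₁) * Sn (a₂ - b₁) * Sn (a₃ - b₁) * Sn (a₄ - b₁) / Real.pi ^ 4 *
        Fstar (1 + a₁ - b₁) (1 + a₂ - b₁) (1 + a₃ - b₁) (1 + a₄ - b₁)
          (1 + b₂ - b₁) (1 + b₃ - b₁) (1 + b₄ - b₁) := by
  rw [recipGammaSum, ← Nat.cast_injective.tsum_eq (f := fun k : ℤ =>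
    recipGammaProd a₁ a₂ a₃ a₄ b₁ b₂ b₃ b₄ (1 - b₁ + k)) ?_, Fstar, ← tsum_mul_left]
  · refine tsum_congr fun k => ?_
    have hne : ∀ {x : ℂ}, (∀ m : ℕ, 1 + x - b₁ ≠ -m) →
        ∀ m : ℕ, 1 - b₁ + ((k : ℤ) : ℂ) + x ≠ -m := fun hx m hm => by
      refine hx (m + k) ?_
      push_cast at hm ⊢
      linear_combination hm
    have hS : ∀ x : ℂ, Sn (1 - b₁ + ((k : ℤ) : ℂ) + x) = (-1) ^ (k + 1) * Sn (x - b₁) := fun x => by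
      have h := Sn_add_int (x - b₁) (k + 1)
      rw [← zpow_natCast]
      push_cast at h ⊢
      rw [← h]
      ring_nf
    rw [recipGammaProd_eq b₁ b₂ b₃ b₄ (hne h₁) (hne h₂) (hne h₃) (hne h₄), hS, hS, hS, hS,
      ← Complex.Gamma_nat_eq_factorial]
    have hpow : (((-1 : ℂ) ^ (k + 1)) ^ 2) ^ 2 = 1 := by
      rw [← pow_mul (-1 : ℂ), mul_comm, pow_mul (-1 : ℂ), neg_one_sq, one_pow, one_pow]
    have hG : ∀ x : ℂ, 1 - b₁ + ((k : ℤ) : ℂ) + x = k + (1 + x - b₁) := fun x => by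
      push_cast
      ring
    rw [hG, hG, hG, hG, hG, hG, hG, hG, show (k : ℂ) + (1 + b₁ - b₁) = k + 1 by ring]
    generalize (-1 : ℂ) ^ (k + 1) = ε at hpow ⊢
    linear_combination (Sn (a₁ - b₁) * Sn (a₂ - b₁) * Sn (a₃ - b₁) * Sn (a₄ - b₁) / Real.pi ^ 4 *
      (Gamma (k + (1 + a₁ - b₁)) * Gamma (k + (1 + a₂ - b₁)) * Gamma (k + (1 + a₃ - b₁)) *
        Gamma (k + (1 + a₄ - b₁)) / (Gamma (k + 1) * Gamma (k + (1 + b₂ - b₁)) *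
        Gamma (k + (1 + b₃ - b₁)) * Gamma (k + (1 + b₄ - b₁))))) * hpow
  · intro k hk
    by_contra hneg
    refine hk ?_
    have hk0 : k < 0 := by
      by_contra h0
      exact hneg ⟨k.toNat, Int.toNat_of_nonneg (not_lt.1 h0)⟩
    obtain ⟨m, rfl⟩ : ∃ m : ℕ, k = -(m + 1) := ⟨(-k - 1).toNat, by omega⟩
    have h0 : Gamma (1 - b₁ + ((-((m : ℤ) + 1) : ℤ) : ℂ) + b₁) = 0 := by
      rw [show 1 - b₁ + ((-((m : ℤ) + 1) : ℤ) : ℂ) + b₁ = -m by push_cast; ring,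
        Complex.Gamma_neg_nat_eq_zero]
    simp only [recipGammaProd, h0, inv_zero, zero_mul, mul_zero]

theorem Sn_eq_exp (x : ℂ) :
    Sn x = (exp (Real.pi * I * x) - (exp (Real.pi * I * x))⁻¹) / (2 * I) := by
  rw [Sn, Complex.sin, ← Complex.exp_neg, eq_div_iff (by simp)]
  have h1 : -((Real.pi : ℂ) * x) * I = -(Real.pi * I * x) := by ring
  have h2 : (Real.pi : ℂ) * x * I = Real.pi * I * x := by ring
  rw [h1, h2]
  linear_combination (exp (-(Real.pi * I * x)) - exp (Real.pi * I * x)) * I_sq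

theorem exp_pi_mul_I_mul_add (x y : ℂ) :
    exp (Real.pi * I * (x + y)) = exp (Real.pi * I * x) * exp (Real.pi * I * y) := by
  rw [mul_add, Complex.exp_add]

theorem exp_pi_mul_I_mul_sub (x y : ℂ) :
    exp (Real.pi * I * (x - y)) = exp (Real.pi * I * x) / exp (Real.pi * I * y) := by
  rw [mul_sub, Complex.exp_sub]

theorem Sn_mul_sub_Sn_mul (b c d f g : ℂ) :
    Sn f * (Sn (g - b) * Sn (g - c) * Sn (g - d)) - Sn g * (Sn (f - b) * Sn (f - c) * Sn (f - d)) =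
      -(Sn (f - g) * (Sn b * Sn c * Sn d + Sn (f + g - b - c - d) * Sn f * Sn g)) := by
  simp only [Sn_eq_exp, exp_pi_mul_I_mul_add, exp_pi_mul_I_mul_sub]
  have hb := Complex.exp_ne_zero (Real.pi * I * b)
  have hc := Complex.exp_ne_zero (Real.pi * I * c)
  have hd := Complex.exp_ne_zero (Real.pi * I * d)
  have hf := Complex.exp_ne_zero (Real.pi * I * f)
  have hg := Complex.exp_ne_zero (Real.pi * I * g)
  generalize exp (Real.pi * I * b) = B at *
  generalize exp (Real.pi * I * c) = C at *
  generalize exp (Real.pi * I * d) = D at *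
  generalize exp (Real.pi * I * f) = F at *
  generalize exp (Real.pi * I * g) = G at *
  have hI : (I : ℂ) ≠ 0 := I_ne_zero
  field_simp
  ring

theorem lagrange_of_eq_exp {P : ℂ → ℂ} {α β γ : ℂ}
    (h : ∀ s, P s = α * exp (-(2 * Real.pi * I * s)) + β + γ * exp (2 * Real.pi * I * s))
    (w x y z : ℂ) :
    P w * (Sn (x - y) * Sn (x - z) * Sn (y - z)) = P x * (Sn (w - y) * Sn (w - z) * Sn (y - z)) -
      P y * (Sn (w - x) * Sn (w - z) * Sn (x - z)) + P z * (Sn (w - x) * Sn (w - y) * Sn (x - y)) := by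
  have h1 : ∀ s : ℂ, exp (2 * Real.pi * I * s) = exp (Real.pi * I * s) ^ 2 := fun s => by
    rw [← Complex.exp_nat_mul]
    push_cast
    ring_nf
  simp only [h, Complex.exp_neg, h1, Sn_eq_exp, exp_pi_mul_I_mul_sub]
  have hw := Complex.exp_ne_zero (Real.pi * I * w)
  have hx := Complex.exp_ne_zero (Real.pi * I * x)
  have hy := Complex.exp_ne_zero (Real.pi * I * y)
  have hz := Complex.exp_ne_zero (Real.pi * I * z)
  generalize exp (Real.pi * I * w) = W at *
  generalize exp (Real.pi * I * x) = X at *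
  generalize exp (Real.pi * I * y) = Y at *
  generalize exp (Real.pi * I * z) = Z at *
  have hI : (I : ℂ) ≠ 0 := I_ne_zero
  field_simp
  ring

theorem Sn_neg (x : ℂ) : Sn (-x) = -Sn x := by
  rw [Sn, Sn, mul_neg, Complex.sin_neg]

theorem Sn_sub_comm (x y : ℂ) : Sn (x - y) = -Sn (y - x) := by
  rw [← Sn_neg, neg_sub]

theorem Sn_one_add (x : ℂ) : Sn (1 + x) = -Sn x := by
  have h := Sn_add_int x 1
  rw [Int.cast_one, zpow_one, neg_one_mul] at h
  rw [add_comm, h]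

theorem Sn_one_sub (x : ℂ) : Sn (1 - x) = Sn x := by
  rw [sub_eq_add_neg, Sn_one_add, Sn_neg, neg_neg]

theorem Sn_ne_zero {x : ℂ} (hx : ∀ n : ℤ, x ≠ n) : Sn x ≠ 0 := by
  intro h
  obtain ⟨n, hn⟩ := Complex.sin_eq_zero_iff.1 h
  have hpi : (Real.pi : ℂ) ≠ 0 := by exact_mod_cast Real.pi_ne_zero
  exact hx n (mul_left_cancel₀ hpi (by rw [hn, mul_comm]))

theorem ne_neg_natCast_of_Sn_ne_zero {x : ℂ} (hx : Sn x ≠ 0) (m : ℕ) : x ≠ -m := by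
  rintro rfl
  refine hx ?_
  have h := Sn_add_int 0 (-m)
  push_cast at h
  rw [zero_add] at h
  rw [h]
  simp [Sn]

theorem inv_Gamma_mul_inv_Gamma {x y : ℂ} (h : x + y = 1) :
    (Gamma x)⁻¹ * (Gamma y)⁻¹ = Sn x / Real.pi := by
  obtain rfl : y = 1 - x := by linear_combination h
  rw [← mul_inv, Complex.Gamma_mul_Gamma_one_sub, inv_div, Sn]

theorem Lf_eq_entirePair_div {a b c d e : ℂ} (f g : ℂ) (ha : Sn a ≠ 0) (hb : Sn b ≠ 0)
    (hc : Sn c ≠ 0) (hd : Sn d ≠ 0) (ha' : Sn (a - e) ≠ 0) (hb' : Sn (b - e) ≠ 0)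
    (hc' : Sn (c - e) ≠ 0) (hd' : Sn (d - e) ≠ 0) :
    Lf a b c d e f g = entirePair a b c d e f g / Sn e := by
  have hp : ∀ {x : ℂ}, Sn (x - e) ≠ 0 → ∀ m : ℕ, 1 + x - e ≠ -m := fun h =>
    ne_neg_natCast_of_Sn_ne_zero (by rw [add_sub_assoc, Sn_one_add]; exact neg_ne_zero.2 h)
  have hp₀ : ∀ {x : ℂ}, Sn x ≠ 0 → ∀ m : ℕ, x ≠ -m := ne_neg_natCast_of_Sn_ne_zero
  have hG := Gamma_ne_zero (hp₀ ha)
  have hG₂ := Gamma_ne_zero (hp₀ hb)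
  have hG₃ := Gamma_ne_zero (hp₀ hc)
  have hG₄ := Gamma_ne_zero (hp₀ hd)
  have hG₅ := Gamma_ne_zero (hp ha')
  have hG₆ := Gamma_ne_zero (hp hb')
  have hG₇ := Gamma_ne_zero (hp hc')
  have hG₈ := Gamma_ne_zero (hp hd')
  rw [Lf, entirePair, Fstar_eq_mul_entireSeries _ _ _ (hp₀ ha) (hp₀ hb) (hp₀ hc) (hp₀ hd),
    Fstar_eq_mul_entireSeries _ _ _ (hp ha') (hp hb') (hp hc') (hp hd')]
  by_cases he : Sn e = 0
  · simp [he]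
  field_simp

theorem Lf_transform {a b c d e f g : ℂ} (hs : e + f + g = a + b + c + d + 1) (ha : Sn a ≠ 0)
    (hb : Sn b ≠ 0) (hc : Sn c ≠ 0) (hd : Sn d ≠ 0) (hae : Sn (a - e) ≠ 0) (hbe : Sn (b - e) ≠ 0)
    (hce : Sn (c - e) ≠ 0) (hde : Sn (d - e) ≠ 0) (haf : Sn (a - f) ≠ 0) (hbf : Sn (b - f) ≠ 0)
    (hcf : Sn (c - f) ≠ 0) (hdf : Sn (d - f) ≠ 0) (hag : Sn (a - g) ≠ 0) (hbg : Sn (b - g) ≠ 0)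
    (hcg : Sn (c - g) ≠ 0) (hdg : Sn (d - g) ≠ 0) (he : Sn e ≠ 0) (hfg : Sn (f - g) ≠ 0) :
    Lf a b c d e f g = Lf (f - b) (f - a) (f - d) (f - c) (1 + f - g) f (1 + f - e) := by
  have h1 : ∀ {x : ℂ}, Sn (x - f) ≠ 0 → Sn (f - x) ≠ 0 := fun h => by
    rw [Sn_sub_comm]
    exact neg_ne_zero.2 h
  have h2 : ∀ {x : ℂ}, Sn (x - g) ≠ 0 → Sn (f - x - (1 + f - g)) ≠ 0 := fun {x} h => by
    rw [show f - x - (1 + f - g) = -(1 + (x - g)) by ring, Sn_neg, Sn_one_add, neg_neg]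
    exact h
  have h3 : Sn (1 + f - g) ≠ 0 := by
    rw [add_sub_assoc, Sn_one_add]
    exact neg_ne_zero.2 hfg
  rw [Lf_eq_entirePair_div f g ha hb hc hd hae hbe hce hde, Lf_eq_entirePair_div f (1 + f - e)
    (h1 hbf) (h1 haf) (h1 hdf) (h1 hcf) (h2 hbg) (h2 hag) (h2 hdg) (h2 hcg), div_eq_div_iff he h3]
  linear_combination entirePair_transform hs

theorem Fstar_swap_upper (a b c d e f g : ℂ) : Fstar b a d c e f g = Fstar a b c d e f g := by
  refine tsum_congr fun k => ?_
  ring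

theorem Fstar_rotate_lower (a b c d e f g : ℂ) : Fstar a b c d f g e = Fstar a b c d e f g := by
  refine tsum_congr fun k => ?_
  ring

/-- Away from the poles, `recipGammaSum` at minus a lower parameter is a Saalschützian series. -/
theorem recipGammaSum_neg_lower {a₁ a₂ a₃ a₄ b₁ : ℂ} (b₂ b₃ b₄ : ℂ) (h₁ : Sn (b₁ - a₁) ≠ 0)
    (h₂ : Sn (b₁ - a₂) ≠ 0) (h₃ : Sn (b₁ - a₃) ≠ 0) (h₄ : Sn (b₁ - a₄) ≠ 0) :
    recipGammaSum a₁ a₂ a₃ a₄ b₁ b₂ b₃ b₄ (-b₁) =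
      Sn (b₁ - a₁) * Sn (b₁ - a₂) * Sn (b₁ - a₃) * Sn (b₁ - a₄) / Real.pi ^ 4 *
        Fstar (1 + a₁ - b₁) (1 + a₂ - b₁) (1 + a₃ - b₁) (1 + a₄ - b₁)
          (1 + b₂ - b₁) (1 + b₃ - b₁) (1 + b₄ - b₁) := by
  have hp : ∀ {x : ℂ}, Sn (b₁ - x) ≠ 0 → ∀ m : ℕ, 1 + x - b₁ ≠ -m := fun {x} h =>
    ne_neg_natCast_of_Sn_ne_zero (by
      rw [add_sub_assoc, Sn_one_add, Sn_sub_comm, neg_neg]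
      exact h)
  rw [← recipGammaSum_add_int _ _ _ _ _ _ _ _ (-b₁) 1, Int.cast_one,
    show -b₁ + 1 = 1 - b₁ by ring, recipGammaSum_one_sub b₂ b₃ b₄ (hp h₁) (hp h₂) (hp h₃) (hp h₄),
    Sn_sub_comm a₁, Sn_sub_comm a₂, Sn_sub_comm a₃, Sn_sub_comm a₄]
  ring

theorem recipGammaSum_rotate_lower (a₁ a₂ a₃ a₄ b₁ b₂ b₃ b₄ s : ℂ) :
    recipGammaSum a₁ a₂ a₃ a₄ b₁ b₂ b₃ b₄ s = recipGammaSum a₁ a₂ a₃ a₄ b₂ b₃ b₄ b₁ s := by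
  refine tsum_congr fun k => ?_
  simp only [recipGammaProd]
  ring

/-- Away from the poles, `recipGammaSum` at minus an upper parameter is a Saalschützian series. -/
theorem recipGammaSum_neg_upper {a₁ b₁ b₂ b₃ b₄ : ℂ} (a₂ a₃ a₄ : ℂ) (h₁ : Sn (b₁ - a₁) ≠ 0)
    (h₂ : Sn (b₂ - a₁) ≠ 0) (h₃ : Sn (b₃ - a₁) ≠ 0) (h₄ : Sn (b₄ - a₁) ≠ 0) :
    recipGammaSum a₁ a₂ a₃ a₄ b₁ b₂ b₃ b₄ (-a₁) =
      Sn (b₁ - a₁) * Sn (b₂ - a₁) * Sn (b₃ - a₁) * Sn (b₄ - a₁) / Real.pi ^ 4 *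
        Fstar (1 + a₁ - b₁) (1 + a₁ - b₂) (1 + a₁ - b₃) (1 + a₁ - b₄)
          (1 + a₁ - a₂) (1 + a₁ - a₃) (1 + a₁ - a₄) := by
  have hd : ∀ b : ℂ, 1 - a₁ - (1 - b) = b - a₁ := fun b => by ring
  have hadd : ∀ b : ℂ, 1 + (1 - b) - (1 - a₁) = 1 + a₁ - b := fun b => by ring
  have h := recipGammaSum_neg_lower (a₁ := 1 - b₁) (a₂ := 1 - b₂) (a₃ := 1 - b₃) (a₄ := 1 - b₄)
    (b₁ := 1 - a₁) (1 - a₂) (1 - a₃) (1 - a₄) (by rwa [hd]) (by rwa [hd]) (by rwa [hd])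
    (by rwa [hd])
  simp only [hd, hadd] at h
  rw [recipGammaSum_neg, ← h, ← recipGammaSum_add_int _ _ _ _ _ _ _ _ (-(1 - a₁)) 1]
  congr 1
  push_cast
  ring

theorem recipGammaSum_neg_lagrange {a b c d e f g : ℂ} (hs : e + f + g = a + b + c + d + 1)
    (w x y : ℂ) :
    recipGammaSum a b c d 1 e f g (-w) * (Sn x * Sn y * Sn (y - x)) =
      recipGammaSum a b c d 1 e f g 0 * (Sn (w - x) * Sn (w - y) * Sn (y - x)) -
      recipGammaSum a b c d 1 e f g (-x) * (Sn w * Sn (w - y) * Sn y) +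
      recipGammaSum a b c d 1 e f g (-y) * (Sn w * Sn (w - x) * Sn x) := by
  obtain ⟨α, β, γ, h⟩ := exists_recipGammaSum_eq (a₁ := a) (a₂ := b) (a₃ := c) (a₄ := d) (b₁ := 1)
    (b₂ := e) (b₃ := f) (b₄ := g) (by linear_combination hs)
  have key := lagrange_of_eq_exp h (-w) 0 (-x) (-y)
  have h1 : ∀ u v : ℂ, Sn (-u - -v) = -Sn (u - v) := fun u v => by rw [← Sn_neg]; ring_nf
  rw [sub_zero, zero_sub, zero_sub, neg_neg, neg_neg, h1, h1, h1, Sn_neg, Sn_sub_comm x] at key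
  linear_combination key

theorem orbit3_KLL_relation (a b c d e f g : ℂ)
    (hsaal : e + f + g = a + b + c + d + 1)
    (hint : ∀ i : Fin 7, ∀ n : ℤ, ![a, b, c, d, e, f, g] i ≠ (n : ℂ))
    (hdiff : ∀ i j : Fin 7, i ≠ j → ∀ n : ℤ,
      ![a, b, c, d, e, f, g] i - ![a, b, c, d, e, f, g] j ≠ (n : ℂ)) :
    Af (1 - a) (e - a) (f - a) (g - a) * B3 a b c d e f g * Kf a b c d e f g +
      Sn (e - a) * Af (f - a) (f - b) (f - c) (f - d) * Af (g - a) (g - b) (g - c) (g - d) *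
        Af a b c d * Lf (1 - a) (1 - b) (1 - c) (1 - d) (2 - e) (2 - f) (2 - g) -
      Af (e - a) (e - b) (e - c) (e - d) * B4 a b c d e f g * Lf a b c d e f g = 0 := by
  have hpi : (Real.pi : ℂ) ≠ 0 := by exact_mod_cast Real.pi_ne_zero
  have ha : Sn a ≠ 0 := Sn_ne_zero (hint 0)
  have hb : Sn b ≠ 0 := Sn_ne_zero (hint 1)
  have hc : Sn c ≠ 0 := Sn_ne_zero (hint 2)
  have hd : Sn d ≠ 0 := Sn_ne_zero (hint 3)
  have he : Sn e ≠ 0 := Sn_ne_zero (hint 4)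
  have hea : Sn (e - a) ≠ 0 := Sn_ne_zero (hdiff 4 0 (by decide))
  have heb : Sn (e - b) ≠ 0 := Sn_ne_zero (hdiff 4 1 (by decide))
  have hec : Sn (e - c) ≠ 0 := Sn_ne_zero (hdiff 4 2 (by decide))
  have hed : Sn (e - d) ≠ 0 := Sn_ne_zero (hdiff 4 3 (by decide))
  have hfa : Sn (f - a) ≠ 0 := Sn_ne_zero (hdiff 5 0 (by decide))
  have hfb : Sn (f - b) ≠ 0 := Sn_ne_zero (hdiff 5 1 (by decide))
  have hfc : Sn (f - c) ≠ 0 := Sn_ne_zero (hdiff 5 2 (by decide))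
  have hfd : Sn (f - d) ≠ 0 := Sn_ne_zero (hdiff 5 3 (by decide))
  have hga : Sn (g - a) ≠ 0 := Sn_ne_zero (hdiff 6 0 (by decide))
  have hgb : Sn (g - b) ≠ 0 := Sn_ne_zero (hdiff 6 1 (by decide))
  have hgc : Sn (g - c) ≠ 0 := Sn_ne_zero (hdiff 6 2 (by decide))
  have hgd : Sn (g - d) ≠ 0 := Sn_ne_zero (hdiff 6 3 (by decide))
  have hfg : Sn (f - g) ≠ 0 := Sn_ne_zero (hdiff 5 6 (by decide))
  have hone : Sn (1 - a) ≠ 0 := by rwa [Sn_one_sub]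
  have hcancel : ∀ x : ℂ, 1 + x - 1 = x := fun x => by ring
  have htwo : ∀ x : ℂ, 1 + 1 - x = 2 - x := fun x => by ring
  have hP0 := recipGammaSum_neg_lower (b₁ := 1) e f g hone (by rwa [Sn_one_sub] : Sn (1 - b) ≠ 0)
    (by rwa [Sn_one_sub] : Sn (1 - c) ≠ 0) (by rwa [Sn_one_sub] : Sn (1 - d) ≠ 0)
  rw [← recipGammaSum_add_int _ _ _ _ _ _ _ _ (-1) 1, Int.cast_one, neg_add_cancel] at hP0
  simp only [hcancel, Sn_one_sub] at hP0
  have hPa := recipGammaSum_neg_upper b c d hone hea hfa hga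
  rw [hcancel, Sn_one_sub] at hPa
  have hPe := recipGammaSum_neg_lower f g 1 hea heb hec hed
  rw [← recipGammaSum_rotate_lower, htwo, Fstar_rotate_lower] at hPe
  have hPf := recipGammaSum_neg_lower g 1 e hfa hfb hfc hfd
  rw [← recipGammaSum_rotate_lower, ← recipGammaSum_rotate_lower, htwo] at hPf
  have hPg := recipGammaSum_neg_lower 1 e f hga hgb hgc hgd
  rw [recipGammaSum_rotate_lower, htwo] at hPg
  have hf := recipGammaSum_neg_lagrange hsaal f a e
  have hg := recipGammaSum_neg_lagrange hsaal g a e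
  rw [hP0, hPa, hPe, hPf] at hf
  rw [hP0, hPa, hPe, hPg] at hg
  have hJ := Sn_mul_sub_Sn_mul b c d
  have hJfg := hJ f g
  have hJfe := hJ f e
  have hJge := hJ g e
  rw [show f + g - b - c - d = 1 - (e - a) by linear_combination hsaal, Sn_one_sub] at hJfg
  rw [show f + e - b - c - d = 1 - (g - a) by linear_combination hsaal, Sn_one_sub] at hJfe
  rw [show g + e - b - c - d = 1 - (f - a) by linear_combination hsaal, Sn_one_sub] at hJge
  have hL : Lf (1 - a) (1 - b) (1 - c) (1 - d) (2 - e) (2 - f) (2 - g) =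
      (Fstar (1 + a - f) (1 + b - f) (1 + c - f) (1 + d - f) (1 + g - f) (2 - f) (1 + e - f) -
        Fstar (1 + a - g) (1 + b - g) (1 + c - g) (1 + d - g) (2 - g) (1 + e - g) (1 + f - g)) /
      Sn (f - g) * ((Gamma (1 + a - f))⁻¹ * (Gamma (1 + b - f))⁻¹ * (Gamma (1 + c - f))⁻¹ *
        (Gamma (1 + d - f))⁻¹ * (Gamma (1 + a - g))⁻¹ * (Gamma (1 + b - g))⁻¹ *
        (Gamma (1 + c - g))⁻¹ * (Gamma (1 + d - g))⁻¹) := by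
    have h1 : ∀ {x y : ℂ}, Sn (y - x) ≠ 0 → Sn (1 - x - (2 - y)) ≠ 0 := fun {x y} h => by
      rw [show 1 - x - (2 - y) = -(1 - (y - x)) by ring, Sn_neg, Sn_one_sub]
      exact neg_ne_zero.2 h
    have h2 : ∀ {x : ℂ}, Sn x ≠ 0 → Sn (1 - x) ≠ 0 := fun h => by rwa [Sn_one_sub]
    rw [Lf_transform (by linear_combination -hsaal) (h2 ha) (h2 hb) (h2 hc) (h2 hd) (h1 hea)
      (h1 heb) (h1 hec) (h1 hed) (h1 hfa) (h1 hfb) (h1 hfc) (h1 hfd) (h1 hga) (h1 hgb) (h1 hgc)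
      (h1 hgd) (by rwa [show 2 - e = 1 + (1 - e) by ring, Sn_one_add, neg_ne_zero, Sn_one_sub])
      (by rwa [show 2 - f - (2 - g) = -(f - g) by ring, Sn_neg, neg_ne_zero]), Lf]
    have h3 : ∀ x : ℂ, 2 - f - (1 - x) = 1 + x - f := fun x => by ring
    have h4 : 1 + (2 - f) - (2 - g) = 1 + g - f := by ring
    have h5 : 1 + (2 - f) - (2 - e) = 1 + e - f := by ring
    have h6 : ∀ x : ℂ, 1 + (1 + x - f) - (1 + g - f) = 1 + x - g := fun x => by ring
    have h7 : 2 - (1 + g - f) = 1 + f - g := by ring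
    have h8 : 1 + (2 - f) - (1 + g - f) = 2 - g := by ring
    have h9 : Sn (1 + g - f) = Sn (f - g) := by
      rw [show 1 + g - f = 1 - (f - g) by ring, Sn_one_sub]
    rw [h3, h3, h3, h3, h4, h5, h6, h6, h6, h6, h6, h7, h8, h9, Fstar_swap_upper,
      Fstar_swap_upper (1 + a - g),
      ← Fstar_rotate_lower _ _ _ _ (1 + f - g), div_eq_mul_inv, div_eq_mul_inv]
    simp only [mul_inv]
    ring
  set F₀ := Fstar a b c d e f g
  set Fₐ := Fstar a (1 + a - e) (1 + a - f) (1 + a - g) (1 + a - b) (1 + a - c) (1 + a - d)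
  set Fₑ := Fstar (1 + a - e) (1 + b - e) (1 + c - e) (1 + d - e) (2 - e) (1 + f - e) (1 + g - e)
  set F₂ := Fstar (1 + a - f) (1 + b - f) (1 + c - f) (1 + d - f) (1 + g - f) (2 - f) (1 + e - f)
  set F₃ := Fstar (1 + a - g) (1 + b - g) (1 + c - g) (1 + d - g) (2 - g) (1 + e - g) (1 + f - g)
  set Γi := (Gamma a)⁻¹ * (Gamma b)⁻¹ * (Gamma c)⁻¹ * (Gamma d)⁻¹
  have hR : ∀ x y : ℂ, (Gamma (y - x))⁻¹ * (Gamma (1 + x - y))⁻¹ = Sn (y - x) / Real.pi :=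
    fun x y => inv_Gamma_mul_inv_Gamma (by ring)
  have hK : Af (1 - a) (e - a) (f - a) (g - a) * B3 a b c d e f g * Kf a b c d e f g =
      Sn (e - a) * Sn (f - a) * Sn (g - a) / Real.pi ^ 4 * B3 a b c d e f g * (F₀ + Fₐ) * Γi := by
    have hRa : (Gamma a)⁻¹ * (Gamma (1 - a))⁻¹ = Sn a / Real.pi :=
      inv_Gamma_mul_inv_Gamma (by ring)
    calc _ = ((Gamma a)⁻¹ * (Gamma (1 - a))⁻¹) * ((Gamma (e - a))⁻¹ * (Gamma (1 + a - e))⁻¹) *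
          ((Gamma (f - a))⁻¹ * (Gamma (1 + a - f))⁻¹) *
          ((Gamma (g - a))⁻¹ * (Gamma (1 + a - g))⁻¹) * (Sn a)⁻¹ * B3 a b c d e f g * (F₀ + Fₐ) *
          Γi := by
          rw [Af, Kf]
          simp only [Γi, F₀, Fₐ, div_eq_mul_inv, mul_inv, pow_two]
          ring
      _ = _ := by
        rw [hRa, hR, hR, hR]
        field_simp
  have hLe : Af (e - a) (e - b) (e - c) (e - d) * B4 a b c d e f g * Lf a b c d e f g =
      Sn (e - a) * Sn (e - b) * Sn (e - c) * Sn (e - d) / Real.pi ^ 4 * B4 a b c d e f g *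
        ((F₀ - Fₑ) / Sn e) * Γi := by
    calc _ = ((Gamma (e - a))⁻¹ * (Gamma (1 + a - e))⁻¹) *
          ((Gamma (e - b))⁻¹ * (Gamma (1 + b - e))⁻¹) *
          ((Gamma (e - c))⁻¹ * (Gamma (1 + c - e))⁻¹) *
          ((Gamma (e - d))⁻¹ * (Gamma (1 + d - e))⁻¹) * B4 a b c d e f g *
          ((F₀ - Fₑ) / Sn e) * Γi := by
          rw [Af, Lf]
          simp only [Γi, F₀, Fₑ, div_eq_mul_inv, mul_inv]
          ring
      _ = _ := by
        rw [hR, hR, hR, hR]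
        ring
  have hLfg : Sn (e - a) * Af (f - a) (f - b) (f - c) (f - d) * Af (g - a) (g - b) (g - c) (g - d) *
        Af a b c d * Lf (1 - a) (1 - b) (1 - c) (1 - d) (2 - e) (2 - f) (2 - g) =
      Sn (e - a) * (Sn (f - a) * Sn (f - b) * Sn (f - c) * Sn (f - d)) *
        (Sn (g - a) * Sn (g - b) * Sn (g - c) * Sn (g - d)) / Real.pi ^ 8 *
        ((F₂ - F₃) / Sn (f - g)) * Γi := by
    rw [hL]
    calc _ = Sn (e - a) * (((Gamma (f - a))⁻¹ * (Gamma (1 + a - f))⁻¹) *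
          ((Gamma (f - b))⁻¹ * (Gamma (1 + b - f))⁻¹) *
          ((Gamma (f - c))⁻¹ * (Gamma (1 + c - f))⁻¹) *
          ((Gamma (f - d))⁻¹ * (Gamma (1 + d - f))⁻¹)) *
          (((Gamma (g - a))⁻¹ * (Gamma (1 + a - g))⁻¹) *
          ((Gamma (g - b))⁻¹ * (Gamma (1 + b - g))⁻¹) *
          ((Gamma (g - c))⁻¹ * (Gamma (1 + c - g))⁻¹) *
          ((Gamma (g - d))⁻¹ * (Gamma (1 + d - g))⁻¹)) *
          ((F₂ - F₃) / Sn (f - g)) * Γi := by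
          simp only [Af, Γi, div_eq_mul_inv, mul_inv]
          ring
      _ = _ := by
        simp only [hR]
        ring
  rw [hK, hLe, hLfg, B3, B4]
  clear_value F₀ Fₐ Fₑ F₂ F₃ Γi
  clear hK hLe hLfg hL hP0 hPa hPe hPf hPg hR hJ hint hdiff
  generalize Sn (f - a) = fa at *
  generalize Sn (f - b) = fb at *
  generalize Sn (f - c) = fc at *
  generalize Sn (f - d) = fd at *
  generalize Sn (g - a) = ga at *
  generalize Sn (g - b) = gb at *
  generalize Sn (g - c) = gc at *
  generalize Sn (g - d) = gd at *
  generalize Sn (e - a) = ea at *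
  generalize Sn (e - b) = eb at *
  generalize Sn (e - c) = ec at *
  generalize Sn (e - d) = ed at *
  generalize Sn (f - e) = fe at *
  generalize Sn (g - e) = ge at *
  generalize Sn (f - g) = fg at *
  have key : fa * ga * ea * Sn e * Sn a * (Sn f * fe * (ga * gb * gc * gd) -
        Sn g * ge * (fa * fb * fc * fd)) * (F₀ + Fₐ) +
      Sn a * Sn e * ea * (fa * fb * fc * fd) * (ga * gb * gc * gd) * (F₂ - F₃) -
      fg * (ea * eb * ec * ed) * fa * ga * (Sn b * Sn c * Sn d + ea * Sn f * Sn g) * Sn a *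
        (F₀ - Fₑ) = 0 := by
    have hf' : (fa * fb * fc * fd) * F₂ * (Sn a * Sn e * ea) =
        Sn a * Sn b * Sn c * Sn d * F₀ * (fa * fe * ea) -
        Sn a * ea * fa * ga * Fₐ * (Sn f * fe * Sn e) +
        ea * eb * ec * ed * Fₑ * (Sn f * fa * Sn a) := by
      field_simp at hf
      linear_combination (fa * Sn a * ea) * hf
    have hg' : (ga * gb * gc * gd) * F₃ * (Sn a * Sn e * ea) =
        Sn a * Sn b * Sn c * Sn d * F₀ * (ga * ge * ea) -
        Sn a * ea * fa * ga * Fₐ * (Sn g * ge * Sn e) +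
        ea * eb * ec * ed * Fₑ * (Sn g * ga * Sn a) := by
      field_simp at hg
      linear_combination (ga * Sn a * ea) * hg
    linear_combination (ga * gb * gc * gd) * hf' - (fa * fb * fc * fd) * hg' +
      fa * ga * Sn a * (ea * eb * ec * ed) * Fₑ * hJfg +
      F₀ * Sn a * fa * ga * ea * (gb * gc * gd * hJfe - fb * fc * fd * hJge - eb * ec * ed * hJfg)
  rw [← mul_zero (Γi / (Real.pi ^ 8 * fg * Sn a * Sn e)), ← key]
  field_simp
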